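/- Let q be a prime power and let n be a natural number with 8 ≤ n ≤ 18. There exists a primitive 2-normal element in F_{q^n} over F_q if and only if gcd(q^3 − q, n) ≠ 1. -/

import Mathlib

open Polynomial

noncomputable section

/-- An element of a finite field is *primitive* if it generates the cyclic multiplicative
group, i.e. its multiplicative order is `card E - 1`. -/
def IsPrimitiveElem {E : Type*} [Field E] [Fintype E] (α : E) : Prop :=
  orderOf α = Fintype.card E - 1

/-- The polynomial `g_α(x) = Σ_{i=0}^{n-1} α^{q^i} x^{n-1-i} ∈ F_{q^n}[x]`. -/
def gPoly {E : Type*} [Field E] (q n : ℕ) (α : E) : Polynomial E :=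
  ∑ i ∈ Finset.range n, C (α ^ q ^ i) * X ^ (n - 1 - i)

/-- `α ∈ F_{q^n}` is `k`-normal over `F_q` if `gcd(x^n - 1, g_α(x))` in `F_{q^n}[x]`
has degree `k`. -/
def IsKNormal {E : Type*} [Field E] (q n k : ℕ) (α : E) : Prop :=
  (@EuclideanDomain.gcd (Polynomial E) _ (Classical.decEq _)
    ((X : Polynomial E) ^ n - 1) (gPoly q n α)).natDegree = k

section CharacterSums

variable {E : Type*} [Field E]

/-- `F` is `θ` times the trivial character plus a combination, of total weight at most `w`, of
nontrivial multiplicative characters killed by `m`. -/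
def CharExpansion (F : E → ℂ) (θ w : ℝ) (m : ℕ) : Prop :=
  ∃ (ι : Type) (_ : Fintype ι) (c : ι → ℂ) (χ : ι → MulChar E ℂ),
    (∀ x, F x = θ * (1 : MulChar E ℂ) x + ∑ i, c i * χ i x) ∧
    (∀ i, χ i ≠ 1 ∧ χ i ^ m = 1) ∧ ∑ i, ‖c i‖ ≤ w

theorem CharExpansion.one : CharExpansion (fun x : E => (1 : MulChar E ℂ) x) 1 0 1 :=
  ⟨Empty, inferInstance, Empty.elim, Empty.elim, by simp, by simp, by simp⟩

theorem mulChar_one_apply_mul (χ : MulChar E ℂ) (x : E) : (1 : MulChar E ℂ) x * χ x = χ x := by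
  rw [← MulChar.mul_apply, one_mul]

theorem CharExpansion.mul {F G : E → ℂ} {θ w θ' w' : ℝ} {m m' : ℕ}
    (hF : CharExpansion F θ w m) (hG : CharExpansion G θ' w' m') (hm : m.Coprime m')
    (hθ : 0 ≤ θ) (hθ' : 0 ≤ θ') :
    CharExpansion (fun x => F x * G x) (θ * θ') (θ * w' + w * θ' + w * w') (m * m') := by
  obtain ⟨ι, _, c, χ, hF1, hχ, hw⟩ := hF
  obtain ⟨κ, _, d, η, hG1, hη, hw'⟩ := hG
  refine ⟨κ ⊕ ι ⊕ ι × κ, inferInstance,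
    Sum.elim (fun k => θ * d k) (Sum.elim (fun i => c i * θ') fun z => c z.1 * d z.2),
    Sum.elim η (Sum.elim χ fun z => χ z.1 * η z.2), ?_, ?_, ?_⟩
  · intro x
    simp only [hF1, hG1, Fintype.sum_sum_type, Sum.elim_inl, Sum.elim_inr, Fintype.sum_prod_type,
      MulChar.mul_apply, add_mul, mul_add]
    have e1 : (θ : ℂ) * (1 : MulChar E ℂ) x * (θ' * (1 : MulChar E ℂ) x) =
        ((θ * θ' : ℝ) : ℂ) * (1 : MulChar E ℂ) x := by
      linear_combination (θ : ℂ) * θ' * mulChar_one_apply_mul 1 x + Complex.ofReal_mul θ θ' *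
        (-(1 : MulChar E ℂ) x)
    have e2 : (θ : ℂ) * (1 : MulChar E ℂ) x * ∑ k, d k * η k x = ∑ k, θ * d k * η k x := by
      rw [Finset.mul_sum]
      refine Finset.sum_congr rfl fun k _ => ?_
      linear_combination (θ : ℂ) * d k * mulChar_one_apply_mul (η k) x
    have e3 : (∑ i, c i * χ i x) * (θ' * (1 : MulChar E ℂ) x) = ∑ i, c i * θ' * χ i x := by
      rw [Finset.sum_mul]
      refine Finset.sum_congr rfl fun i _ => ?_
      linear_combination c i * θ' * mulChar_one_apply_mul (χ i) x
    have e4 : (∑ i, c i * χ i x) * ∑ k, d k * η k x =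
        ∑ i, ∑ k, c i * d k * (χ i x * η k x) := by
      rw [Finset.sum_mul_sum]
      refine Finset.sum_congr rfl fun i _ => Finset.sum_congr rfl fun k _ => by ring
    rw [e1, e2, e3, e4]
    ring
  · rintro (k | i | ⟨i, k⟩)
    · exact ⟨(hη k).1, by simp [mul_comm m, pow_mul, (hη k).2]⟩
    · exact ⟨(hχ i).1, by simp [pow_mul, (hχ i).2]⟩
    · refine ⟨fun h => (hχ i).1 ?_, ?_⟩
      · simp only [Sum.elim_inr] at h
        have h2 : χ i ^ m' = 1 := by
          rw [eq_inv_of_mul_eq_one_left h, inv_pow, (hη k).2, inv_one]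
        have h3 : orderOf (χ i) ∣ m.gcd m' :=
          Nat.dvd_gcd (orderOf_dvd_of_pow_eq_one (hχ i).2) (orderOf_dvd_of_pow_eq_one h2)
        rw [hm, Nat.dvd_one, orderOf_eq_one_iff] at h3
        exact h3
      · simp only [Sum.elim_inr, mul_pow]
        rw [pow_mul, (hχ i).2, one_pow, mul_comm m, pow_mul, (hη k).2, one_pow, one_mul]
  · simp only [Fintype.sum_sum_type, Sum.elim_inl, Sum.elim_inr, Fintype.sum_prod_type, norm_mul,
      ← Finset.mul_sum, ← Finset.sum_mul, Complex.norm_real, Real.norm_of_nonneg hθ,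
      Real.norm_of_nonneg hθ']
    have h0 : 0 ≤ ∑ i, ‖c i‖ := Finset.sum_nonneg fun _ _ => norm_nonneg _
    have h0' : 0 ≤ ∑ i, ‖d i‖ := Finset.sum_nonneg fun _ _ => norm_nonneg _
    have := mul_le_mul hw hw' h0' (h0.trans hw)
    have := mul_le_mul_of_nonneg_left hw' hθ
    have := mul_le_mul_of_nonneg_right hw hθ'
    linarith

variable [Fintype E]

theorem norm_mulChar_le_one (χ : MulChar E ℂ) (x : E) : ‖χ x‖ ≤ 1 := by
  by_cases hx : x = 0
  · simp [hx, MulChar.map_zero]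
  · have h : χ x ^ (Fintype.card E - 1) = 1 := by
      rw [← map_pow, FiniteField.pow_card_sub_one_eq_one x hx, map_one]
    have hpos : Fintype.card E - 1 ≠ 0 := by
      have := Fintype.one_lt_card (α := E)
      omega
    exact (Complex.norm_eq_one_of_pow_eq_one h hpos).le

open Classical in
/-- The sum of a nontrivial multiplicative character over an additive subgroup of a finite field
is at most the square root of the cardinality of the field. -/
theorem norm_sum_mulChar_addSubgroup_le {χ : MulChar E ℂ} (hχ : χ ≠ 1) (V : AddSubgroup E) :
    ‖∑ v : V, χ v‖ ≤ √(Fintype.card E) := by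
  obtain ⟨ψ, hψ⟩ : ∃ ψ : AddChar E ℂ, ψ.IsPrimitive :=
    ⟨_, AddChar.FiniteField.primitiveChar_to_Complex_isPrimitive E⟩
  have hχ' : χ⁻¹ ≠ 1 := inv_ne_one.mpr hχ
  have hG : ‖gaussSum χ⁻¹ ψ‖ = √(Fintype.card E) := by
    have h := gaussSum_mul_gaussSum_eq_card hχ' hψ
    rw [← star_gaussSum_eq] at h
    have h2 := congrArg norm h
    rw [norm_mul, norm_star, Complex.norm_natCast] at h2
    rw [← h2, Real.sqrt_mul_self (norm_nonneg _)]
  have key (x : E) : χ x * gaussSum χ⁻¹ ψ = ∑ a, χ⁻¹ a * ψ (a * x) := by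
    by_cases hx : x = 0
    · subst hx
      simp [MulChar.map_zero, MulChar.sum_eq_zero_of_ne_one hχ']
    · have h := gaussSum_mulShift_eq χ⁻¹ ψ (Units.mk0 x hx)
      rw [inv_inv, Units.val_mk0] at h
      rw [← h, gaussSum]
      simp [AddChar.mulShift_apply, mul_comm]
  have hsum : (∑ v : V, χ v) * gaussSum χ⁻¹ ψ = ∑ a, χ⁻¹ a * ∑ v : V, ψ (a * v) := by
    rw [Finset.sum_mul]
    simp_rw [key, Finset.mul_sum]
    exact Finset.sum_comm
  have hinner (a : E) : ∃ m : ℕ, ∑ v : V, ψ (a * v) = m := by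
    let ψ' : AddChar V ℂ := (ψ.mulShift a).compAddMonoidHom V.subtype
    have e : ∑ v : V, ψ (a * v) = ∑ v : V, ψ' v := by
      simp [ψ', AddChar.mulShift_apply]
    rw [e, AddChar.sum_eq_ite]
    split_ifs
    · exact ⟨_, rfl⟩
    · exact ⟨0, by simp⟩
  have htot : ∑ a : E, ∑ v : V, ψ (a * v) = Fintype.card E := by
    rw [Finset.sum_comm]
    have : ∀ v : V, ∑ a : E, ψ (a * v) = if v = 0 then (Fintype.card E : ℂ) else 0 := by
      intro v
      rw [AddChar.sum_mulShift _ hψ]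
      simp
    simp_rw [this]
    simp
  choose m hm using hinner
  have hmtot : (∑ a, (m a : ℝ)) = Fintype.card E := by
    have : ((∑ a, m a : ℕ) : ℂ) = (Fintype.card E : ℕ) := by
      rw [← htot]; push_cast; simp [hm]
    exact_mod_cast this
  have hle : ‖∑ v : V, χ v‖ * √(Fintype.card E) ≤ Fintype.card E := by
    rw [← hG, ← norm_mul, hsum, ← hmtot]
    refine (norm_sum_le _ _).trans (Finset.sum_le_sum fun a _ => ?_)
    rw [norm_mul, hm, Complex.norm_natCast]
    have h1 : ‖χ⁻¹ a‖ ≤ 1 := norm_mulChar_le_one _ _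
    nlinarith [Nat.cast_nonneg (α := ℝ) (m a)]
  have hpos : 0 < √(Fintype.card E : ℝ) := by
    have : 0 < Fintype.card E := Fintype.card_pos
    positivity
  have hs : √(Fintype.card E : ℝ) * √(Fintype.card E) = Fintype.card E :=
    Real.mul_self_sqrt (by positivity)
  nlinarith

open Classical in
/-- The indicator function of the nonzero `r`-th powers, for `r` a prime divisor of `|E| - 1`. -/
theorem charExpansion_powers {r : ℕ} (hr : r.Prime) (hrE : r ∣ Fintype.card E - 1) :
    CharExpansion (fun x : E => if x ≠ 0 ∧ x ^ ((Fintype.card E - 1) / r) = 1 then 1 else 0)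
      (1 / r) (1 - 1 / r) r := by
  obtain ⟨χ, hχ⟩ := MulChar.exists_mulChar_orderOf E hrE
    (Complex.isPrimitiveRoot_exp r hr.ne_zero)
  obtain ⟨g, hg⟩ := IsCyclic.exists_generator (α := Eˣ)
  have hN : 0 < Fintype.card E - 1 := by
    have := Fintype.one_lt_card (α := E)
    omega
  have hgord : orderOf g = Fintype.card E - 1 := by
    rw [orderOf_eq_card_of_forall_mem_zpowers hg, Nat.card_eq_fintype_card, Fintype.card_units]
  have hχg (k : ℕ) : χ (g : E) ^ k = 1 ↔ r ∣ k := by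
    rw [← hχ, orderOf_dvd_iff_pow_eq_one, MulChar.eq_iff hg, MulChar.pow_apply_coe,
      MulChar.one_apply_coe]
  have hr0 : (r : ℂ) ≠ 0 := by exact_mod_cast hr.ne_zero
  have hkey (x : E) (hx : x ≠ 0) : χ x = 1 ↔ x ^ ((Fintype.card E - 1) / r) = 1 := by
    obtain ⟨k, rfl⟩ : ∃ k : ℕ, x = (g : E) ^ k := by
      obtain ⟨k, hk⟩ := Submonoid.mem_powers_iff _ _ |>.1
        ((isOfFinOrder_of_finite g).mem_powers_iff_mem_zpowers.2 (hg (Units.mk0 x hx)))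
      exact ⟨k, by simpa using congrArg Units.val hk.symm⟩
    rw [map_pow, hχg, ← pow_mul, ← Units.val_pow_eq_pow_val, Units.val_eq_one,
      ← orderOf_dvd_iff_pow_eq_one, hgord]
    obtain ⟨e, he⟩ := hrE
    have he0 : 0 < e := Nat.pos_of_ne_zero (by rintro rfl; omega)
    rw [he, Nat.mul_div_cancel_left _ hr.pos, Nat.mul_dvd_mul_iff_right he0]
  refine ⟨Fin (r - 1), inferInstance, fun _ => 1 / r, fun j => χ ^ (j.val + 1), ?_, ?_, ?_⟩
  · intro x
    by_cases hx : x = 0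
    · simp [hx, MulChar.map_zero]
    have hpow (j : ℕ) : (χ ^ (j + 1)) x = χ x ^ (j + 1) := by
      rw [MulChar.pow_apply' _ (by omega)]
    simp only [hx, ne_eq, not_false_eq_true, true_and, hpow, ← Finset.mul_sum]
    rw [MulChar.one_apply (isUnit_iff_ne_zero.2 hx)]
    have hs : ∑ j : Fin (r - 1), χ x ^ (j.val + 1) = ∑ j ∈ Finset.range r, χ x ^ j - 1 := by
      obtain ⟨s, rfl⟩ : ∃ s, r = s + 1 := ⟨r - 1, by have := hr.pos; omega⟩
      rw [Finset.sum_range_succ', Finset.sum_range]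
      simp
    rw [hs]
    by_cases h1 : χ x = 1
    · rw [if_pos ((hkey x hx).1 h1), h1]
      simp
      field_simp
      ring
    · rw [if_neg fun h => h1 ((hkey x hx).2 h), geom_sum_eq h1]
      have : χ x ^ r = 1 := by
        rw [← MulChar.pow_apply' _ hr.ne_zero, ← hχ, pow_orderOf_eq_one,
          MulChar.one_apply (isUnit_iff_ne_zero.2 hx)]
      rw [this]
      push_cast
      ring
  · intro j
    refine ⟨fun h => ?_, ?_⟩
    · have := orderOf_dvd_of_pow_eq_one h
      rw [hχ] at this
      have := Nat.le_of_dvd (by omega) this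
      have := j.2
      omega
    · rw [← pow_mul, mul_comm, pow_mul, orderOf_dvd_iff_pow_eq_one.1 hχ.dvd, one_pow]
  · have hrR : (r : ℝ) ≠ 0 := by exact_mod_cast hr.ne_zero
    simp [Nat.cast_sub hr.pos]
    field_simp
    linarith

open Classical in
theorem charExpansion_nonpowers {r : ℕ} (hr : r.Prime) (hrE : r ∣ Fintype.card E - 1) :
    CharExpansion (fun x : E => if x ≠ 0 ∧ x ^ ((Fintype.card E - 1) / r) ≠ 1 then 1 else 0)
      (1 - 1 / r) (1 - 1 / r) r := by
  obtain ⟨ι, _, c, χ, h1, h2, h3⟩ := charExpansion_powers (E := E) hr hrE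
  refine ⟨ι, inferInstance, fun i => -c i, χ, fun x => ?_, h2, by simpa using h3⟩
  have h4 : (∑ i, -c i * χ i x) = -∑ i, c i * χ i x := by
    rw [← Finset.sum_neg_distrib]
    simp
  have h5 := h1 x
  rw [h4]
  by_cases hx : x = 0
  · simp only [hx, ne_eq, not_true_eq_false, false_and, if_false, MulChar.map_zero, mul_zero,
      zero_add] at h5 ⊢
    simp
  · rw [MulChar.one_apply (isUnit_iff_ne_zero.2 hx)] at h5 ⊢
    by_cases hp : x ^ ((Fintype.card E - 1) / r) = 1
    · simp only [hx, hp, ne_eq, not_false_eq_true, true_and, if_true, not_true_eq_false,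
        if_false] at h5 ⊢
      push_cast at h5 ⊢
      linear_combination -h5
    · simp only [hx, hp, ne_eq, not_false_eq_true, true_and, if_true, if_false] at h5 ⊢
      push_cast at h5 ⊢
      linear_combination -h5

theorem prod_one_sub_inv_nonneg (C : Finset ℕ) : 0 ≤ ∏ r ∈ C, (1 - 1 / (r : ℝ)) := by
  refine Finset.prod_nonneg fun r _ => ?_
  rcases Nat.eq_zero_or_pos r with rfl | h
  · simp
  · rw [sub_nonneg, div_le_one (by positivity)]
    exact_mod_cast h

open Classical in
/-- The indicator function of the nonzero elements that are not `r`-th powers for any `r ∈ C`. -/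
theorem charExpansion_free (C : Finset ℕ)
    (hC : ∀ r ∈ C, r.Prime ∧ r ∣ Fintype.card E - 1) :
    CharExpansion
      (fun x : E => if x ≠ 0 ∧ ∀ r ∈ C, x ^ ((Fintype.card E - 1) / r) ≠ 1 then 1 else 0)
      (∏ r ∈ C, (1 - 1 / (r : ℝ))) ((∏ r ∈ C, (1 - 1 / (r : ℝ))) * (2 ^ C.card - 1))
      (∏ r ∈ C, r) := by
  induction C using Finset.induction_on with
  | empty =>
    convert CharExpansion.one (E := E) using 1
    · funext x
      by_cases hx : x = 0
      · simp [hx, MulChar.map_zero]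
      · simp [hx, MulChar.one_apply (isUnit_iff_ne_zero.2 hx)]
    all_goals simp
  | insert r C hr ih =>
    have hC' : ∀ r ∈ C, r.Prime ∧ r ∣ Fintype.card E - 1 :=
      fun s hs => hC s (Finset.mem_insert_of_mem hs)
    obtain ⟨hrp, hrd⟩ := hC r (Finset.mem_insert_self _ _)
    have hcop : r.Coprime (∏ s ∈ C, s) := Nat.Coprime.prod_right fun s hs =>
      (Nat.coprime_primes hrp (hC' s hs).1).2 (by rintro rfl; exact hr hs)
    convert (charExpansion_nonpowers (E := E) hrp hrd).mul (ih hC') hcop ?_ ?_ using 1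
    · funext x
      by_cases hx : x = 0
      · simp [hx]
      · by_cases h1 : x ^ ((Fintype.card E - 1) / r) = 1 <;> simp [hx, h1]
    · rw [Finset.prod_insert hr]
    · rw [Finset.prod_insert hr, Finset.card_insert_of_notMem hr]
      ring
    · rw [Finset.prod_insert hr]
    · have := prod_one_sub_inv_nonneg {r}
      simpa using this
    · exact prod_one_sub_inv_nonneg C

open Classical in
theorem CharExpansion.abs_card_sub_le {P : E → Prop} [DecidablePred P] {θ w : ℝ} {m : ℕ}
    (h : CharExpansion (fun x : E => if P x then 1 else 0) θ w m) (V : AddSubgroup E) :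
    |((Finset.univ.filter fun x => x ∈ V ∧ P x).card : ℝ) - θ * (Nat.card V - 1)| ≤
      w * √(Fintype.card E) := by
  obtain ⟨ι, _, c, χ, h1, h2, h3⟩ := h
  have hcard : ((Finset.univ.filter fun x => x ∈ V ∧ P x).card : ℂ) =
      ∑ v : V, if P v then 1 else 0 := by
    rw [← Finset.sum_subtype (Finset.univ.filter fun x => x ∈ V) (by simp)
      (fun x : E => if P x then (1 : ℂ) else 0), Finset.sum_boole, Finset.filter_filter]
  have hone : ∑ v : V, (1 : MulChar E ℂ) v = Nat.card V - 1 := by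
    have : ∀ v : V, (1 : MulChar E ℂ) v = 1 - if v = 0 then 1 else 0 := by
      intro v
      by_cases hv : v = 0
      · simp [hv, MulChar.map_zero]
      · rw [MulChar.one_apply (isUnit_iff_ne_zero.2 (by simpa using hv))]
        simp [hv]
    simp [this, Finset.sum_sub_distrib]
  have hsum : ((Finset.univ.filter fun x => x ∈ V ∧ P x).card : ℂ) - θ * (Nat.card V - 1) =
      ∑ i, c i * ∑ v : V, χ i v := by
    rw [hcard, Finset.sum_congr rfl fun (v : V) _ => h1 v, Finset.sum_add_distrib, ← Finset.mul_sum,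
      hone, add_sub_cancel_left, Finset.sum_comm]
    simp_rw [Finset.mul_sum]
  have hn : ‖((Finset.univ.filter fun x => x ∈ V ∧ P x).card : ℂ) - θ * (Nat.card V - 1)‖ ≤
      w * √(Fintype.card E) := by
    rw [hsum]
    refine (norm_sum_le _ _).trans (le_trans (Finset.sum_le_sum fun i _ => ?_)
      ((Finset.sum_mul _ _ _).symm.le.trans
        (mul_le_mul_of_nonneg_right h3 (Real.sqrt_nonneg _))))
    rw [norm_mul]
    exact mul_le_mul_of_nonneg_left (norm_sum_mulChar_addSubgroup_le (h2 i).1 V) (norm_nonneg _)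
  rw [← Real.norm_eq_abs, ← Complex.norm_real]
  push_cast
  exact hn

open Classical in
/-- The prime sieve: the primes of `C` are treated exactly, those of `S` and the subgroups `U j`
are sieved out. -/
theorem exists_mem_of_sieve {ι : Type*} (V : AddSubgroup E) (J : Finset ι) (U : ι → AddSubgroup E)
    (C S : Finset ℕ) (hCS : Disjoint C S)
    (hp : ∀ r ∈ C ∪ S, r.Prime ∧ r ∣ Fintype.card E - 1)
    (hineq : 2 ^ C.card * (1 + S.card + J.card : ℝ) * √(Fintype.card E) <
      Nat.card V * (1 - ∑ p ∈ S, 1 / (p : ℝ)) - ∑ j ∈ J, (Nat.card (U j) : ℝ)) :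
    ∃ v ∈ V, v ≠ 0 ∧ (∀ j ∈ J, v ∉ U j) ∧
      ∀ r ∈ C ∪ S, v ^ ((Fintype.card E - 1) / r) ≠ 1 := by
  by_contra! hcon
  set Q : ℝ := √(Fintype.card E) with hQ
  set P : E → Prop := fun x => x ≠ 0 ∧ ∀ r ∈ C, x ^ ((Fintype.card E - 1) / r) ≠ 1 with hP
  set θ : ℝ := ∏ r ∈ C, (1 - 1 / (r : ℝ)) with hθ
  have hpC : ∀ r ∈ C, r.Prime ∧ r ∣ Fintype.card E - 1 :=
    fun r hr => hp r (Finset.mem_union_left _ hr)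
  have hpS : ∀ r ∈ S, r.Prime ∧ r ∣ Fintype.card E - 1 :=
    fun r hr => hp r (Finset.mem_union_right _ hr)
  have hθpos : 0 < θ := Finset.prod_pos fun r hr => by
    have : (1 : ℝ) < r := by exact_mod_cast (hpC r hr).1.one_lt
    rw [sub_pos, div_lt_one (by linarith)]
    exact this
  set W : ℝ := 2 ^ C.card with hW
  have hexp : CharExpansion (fun x : E => if P x then 1 else 0) θ (θ * (W - 1))
      (∏ r ∈ C, r) := by
    convert charExpansion_free (E := E) C hpC
  have hN0 := (abs_le.1 (hexp.abs_card_sub_le V)).1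
  have hNU : ∀ j ∈ J, ((Finset.univ.filter fun x => x ∈ U j ∧ P x).card : ℝ) ≤
      θ * (Nat.card (U j) - 1) + θ * (W - 1) * Q := fun j _ => by
    have := (abs_le.1 (hexp.abs_card_sub_le (U j))).2
    linarith
  have hNS : ∀ p ∈ S, ((Finset.univ.filter fun x =>
      x ∈ V ∧ (P x ∧ x ^ ((Fintype.card E - 1) / p) = 1)).card : ℝ) ≤
      θ * (1 / p) * (Nat.card V - 1) + θ * (W - 1 / p) * Q := fun p hpp => by
    obtain ⟨hp1, hp2⟩ := hpS p hpp
    have hcop : (∏ s ∈ C, s).Coprime p := Nat.Coprime.prod_left fun s hs =>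
      (Nat.coprime_primes (hpC s hs).1 hp1).2
        (by rintro rfl; exact Finset.disjoint_left.1 hCS hs hpp)
    have h := hexp.mul (charExpansion_powers (E := E) hp1 hp2) hcop hθpos.le (by positivity)
    have h' : CharExpansion (fun x : E =>
        if P x ∧ x ^ ((Fintype.card E - 1) / p) = 1 then 1 else 0) (θ * (1 / p))
        (θ * (1 - 1 / p) + θ * (W - 1) * (1 / p) + θ * (W - 1) * (1 - 1 / p))
        ((∏ s ∈ C, s) * p) := by
      convert h using 1
      funext x
      by_cases hx : x = 0
      · simp [hx, hP]
      · by_cases h1 : P x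
        · by_cases h2 : x ^ ((Fintype.card E - 1) / p) = 1
          · rw [if_pos ⟨h1, h2⟩, if_pos h1, if_pos ⟨hx, h2⟩, one_mul]
          · rw [if_neg fun h => h2 h.2, if_neg (c := _ ∧ _) fun h => h2 h.2, mul_zero]
        · rw [if_neg fun h => h1 h.1, if_neg h1, zero_mul]
    have := (abs_le.1 (h'.abs_card_sub_le V)).2
    linarith
  have hcover : (Finset.univ.filter fun x => x ∈ V ∧ P x) ⊆
      (J.biUnion fun j => Finset.univ.filter fun x => x ∈ U j ∧ P x) ∪
      (S.biUnion fun p => Finset.univ.filter fun x =>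
        x ∈ V ∧ (P x ∧ x ^ ((Fintype.card E - 1) / p) = 1)) := by
    intro x hx
    simp only [Finset.mem_filter, Finset.mem_univ, true_and, Finset.mem_union,
      Finset.mem_biUnion] at hx ⊢
    by_cases hJ : ∃ j ∈ J, x ∈ U j
    · obtain ⟨j, hj, hxj⟩ := hJ
      exact Or.inl ⟨j, hj, hxj, hx.2⟩
    · push Not at hJ
      obtain ⟨r, hr, hr1⟩ := hcon x hx.1 hx.2.1 hJ
      rcases Finset.mem_union.1 hr with h | h
      · exact absurd hr1 (hx.2.2 r h)
      · exact Or.inr ⟨r, h, hx.1, hx.2, hr1⟩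
  have hcount := (Finset.card_le_card hcover).trans (Finset.card_union_le _ _)
  have hcountR : ((Finset.univ.filter fun x => x ∈ V ∧ P x).card : ℝ) ≤
      (∑ j ∈ J, (θ * (Nat.card (U j) - 1) + θ * (W - 1) * Q)) +
      ∑ p ∈ S, (θ * (1 / p) * (Nat.card V - 1) + θ * (W - 1 / p) * Q) := by
    have h1 : ((J.biUnion fun j => Finset.univ.filter fun x => x ∈ U j ∧ P x).card : ℝ) ≤
        ∑ j ∈ J, (θ * (Nat.card (U j) - 1) + θ * (W - 1) * Q) := by
      refine le_trans ?_ (Finset.sum_le_sum hNU)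
      exact_mod_cast Finset.card_biUnion_le
    have h2 : ((S.biUnion fun p => Finset.univ.filter fun x =>
        x ∈ V ∧ (P x ∧ x ^ ((Fintype.card E - 1) / p) = 1)).card : ℝ) ≤
        ∑ p ∈ S, (θ * (1 / p) * (Nat.card V - 1) + θ * (W - 1 / p) * Q) := by
      refine le_trans ?_ (Finset.sum_le_sum hNS)
      exact_mod_cast Finset.card_biUnion_le
    have h3 : ((Finset.univ.filter fun x => x ∈ V ∧ P x).card : ℝ) ≤ _ := Nat.cast_le.2 hcount
    push_cast at h3
    linarith
  have hs1 : ∑ j ∈ J, (θ * ((Nat.card (U j) : ℝ) - 1) + θ * (W - 1) * Q) =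
      θ * (∑ j ∈ J, (Nat.card (U j) : ℝ) + J.card * ((W - 1) * Q - 1)) := by
    rw [Finset.sum_add_distrib, ← Finset.mul_sum, Finset.sum_sub_distrib]
    simp
    ring
  have hs2 : ∑ p ∈ S, (θ * (1 / (p : ℝ)) * ((Nat.card V : ℝ) - 1) + θ * (W - 1 / p) * Q) =
      θ * ((∑ p ∈ S, 1 / (p : ℝ)) * (Nat.card V - 1 - Q) + S.card * (W * Q)) := by
    have : ∀ p ∈ S, (θ * (1 / (p : ℝ)) * ((Nat.card V : ℝ) - 1) + θ * (W - 1 / p) * Q) =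
      θ * (1 / (p : ℝ) * (Nat.card V - 1 - Q) + W * Q) := fun p _ => by ring
    rw [Finset.sum_congr rfl this, ← Finset.mul_sum, Finset.sum_add_distrib, ← Finset.sum_mul]
    simp
  rw [hs1, hs2] at hcountR
  set σ : ℝ := ∑ p ∈ S, 1 / (p : ℝ) with hσ
  have hσ0 : 0 ≤ σ := Finset.sum_nonneg fun _ _ => by positivity
  have hQ1 : 1 ≤ Q := Real.one_le_sqrt.2 (by exact_mod_cast Fintype.card_pos)
  have hW1 : 1 ≤ W := one_le_pow₀ (by norm_num)
  have hfin : (Nat.card V : ℝ) - 1 - (W - 1) * Q ≤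
      (∑ j ∈ J, (Nat.card (U j) : ℝ) + J.card * ((W - 1) * Q - 1)) +
      (σ * (Nat.card V - 1 - Q) + S.card * (W * Q)) := by
    refine le_of_mul_le_mul_left ?_ hθpos
    linarith
  have hJ0 : (0 : ℝ) ≤ J.card := Nat.cast_nonneg _
  nlinarith [mul_nonneg hJ0 (by linarith : 0 ≤ Q), mul_nonneg hσ0 (by linarith : 0 ≤ Q)]

end CharacterSums

section Frobenius

theorem gPoly_pow {E : Type*} [Field E] {q n : ℕ} (hn : n ≠ 0) {β : E} (hβ : β ^ q ^ n = β) :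
    gPoly q n (β ^ q) = X * gPoly q n β - C β * (X ^ n - 1) := by
  obtain ⟨m, rfl⟩ := Nat.exists_eq_succ_of_ne_zero hn
  unfold gPoly
  rw [Finset.sum_range_succ, Finset.sum_range_succ' _ m, mul_add, Finset.mul_sum, ← pow_mul,
    ← pow_succ', hβ, add_sub_assoc]
  have h1 : ∀ i ∈ Finset.range m, C ((β ^ q) ^ q ^ i) * X ^ (m + 1 - 1 - i) =
      X * (C (β ^ q ^ (i + 1)) * X ^ (m + 1 - 1 - (i + 1))) := fun i hi => by
    have hi := Finset.mem_range.1 hi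
    rw [← pow_mul, ← pow_succ', show m + 1 - 1 - i = m + 1 - 1 - (i + 1) + 1 by omega]
    ring
  rw [Finset.sum_congr rfl h1]
  simp
  ring

theorem coeff_gPoly_last {E : Type*} [Field E] {q n : ℕ} (hn : n ≠ 0) (α : E) :
    (gPoly q n α).coeff (n - 1) = α := by
  unfold gPoly
  rw [finsetSum_coeff, Finset.sum_eq_single 0]
  · simp
  · intro i hi h
    have := Finset.mem_range.1 hi
    rw [coeff_C_mul_X_pow, if_neg (by omega)]
  · intro h
    simp [Nat.pos_of_ne_zero hn] at h

theorem degree_gPoly_lt {E : Type*} [Field E] {q n : ℕ} (α : E) :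
    (gPoly q n α).degree < n := by
  unfold gPoly
  refine (degree_sum_le _ _).trans_lt ((Finset.sup_lt_iff (WithBot.bot_lt_coe n)).2
    fun i hi => (degree_C_mul_X_pow_le _ _).trans_lt ?_)
  have := Finset.mem_range.1 hi
  exact Nat.cast_lt.2 (by omega : n - 1 - i < n)

theorem X_pow_sub_one_dvd_gPoly_iff {E : Type*} [Field E] {q n : ℕ} (hq : q ≠ 0) (hn : n ≠ 0)
    (α : E) : X ^ n - 1 ∣ gPoly q n α ↔ α = 0 := by
  constructor
  · intro h
    have h0 : gPoly q n α = 0 := by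
      refine eq_zero_of_dvd_of_degree_lt h ?_
      rw [show (X ^ n - 1 : E[X]) = X ^ n - C 1 by simp, degree_X_pow_sub_C (Nat.pos_of_ne_zero hn)]
      exact degree_gPoly_lt α
    rw [← coeff_gPoly_last (q := q) hn α, h0, coeff_zero]
  · rintro rfl
    simp [gPoly, hq]

variable {K E : Type*} [Field K] [Fintype K] [Field E] [Fintype E] [Algebra K E]

local notation "φ" => AlgHom.toLinearMap (FiniteField.frobeniusAlgHom K E)

omit [Fintype E] in
theorem gPoly_add {n : ℕ} (α β : E) : gPoly (Fintype.card K) n (α + β) =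
    gPoly (Fintype.card K) n α + gPoly (Fintype.card K) n β := by
  unfold gPoly
  rw [← Finset.sum_add_distrib]
  refine Finset.sum_congr rfl fun i _ => ?_
  have : ∀ x : E, x ^ Fintype.card K ^ i = (FiniteField.frobeniusAlgHom K E ^ i) x := by
    intro x
    clear * -
    induction i with
    | zero => simp
    | succ i ih =>
      rw [pow_succ, pow_mul, ih, pow_succ']
      simp
  rw [this, this, this, map_add, C_add, add_mul]

omit [Fintype E] in
theorem gPoly_smul {n : ℕ} (c : K) (α : E) : gPoly (Fintype.card K) n (c • α) =
    C (algebraMap K E c) * gPoly (Fintype.card K) n α := by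
  unfold gPoly
  rw [Finset.mul_sum]
  refine Finset.sum_congr rfl fun i _ => ?_
  rw [Algebra.smul_def, mul_pow, ← map_pow, FiniteField.pow_card_pow, C_mul, mul_assoc]

theorem X_pow_sub_one_dvd_map_mul_gPoly_sub {n : ℕ} (hn : n ≠ 0)
    (hE : Fintype.card E = Fintype.card K ^ n) (h : K[X]) (α : E) :
    X ^ n - 1 ∣ h.map (algebraMap K E) * gPoly (Fintype.card K) n α -
      gPoly (Fintype.card K) n (aeval φ h α) := by
  induction h using Polynomial.induction_on generalizing α with
  | C a =>
    simp only [map_C, aeval_C, Module.algebraMap_end_apply]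
    rw [gPoly_smul, sub_self]
    exact dvd_zero _
  | add p q hp hq =>
    rw [Polynomial.map_add, map_add, LinearMap.add_apply, gPoly_add, add_mul, add_sub_add_comm]
    exact dvd_add (hp α) (hq α)
  | monomial k a ih =>
    have h1 := ih (α ^ Fintype.card K)
    have h2 : aeval φ (C a * X ^ (k + 1)) α = aeval φ (C a * X ^ k) (α ^ Fintype.card K) := by
      rw [pow_succ, ← mul_assoc, map_mul, Module.End.mul_apply, aeval_X]
      simp
    rw [h2, pow_succ, ← mul_assoc, Polynomial.map_mul, map_X]
    rw [gPoly_pow hn (by rw [← hE, FiniteField.pow_card])] at h1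
    have := dvd_add h1 (dvd_mul_of_dvd_right (dvd_refl (X ^ n - 1))
      ((C a * X ^ k).map (algebraMap K E) * C α))
    convert this using 1
    ring

theorem X_pow_sub_one_dvd_map_mul_gPoly_iff {n : ℕ} (hn : n ≠ 0)
    (hE : Fintype.card E = Fintype.card K ^ n) (h : K[X]) (α : E) :
    X ^ n - 1 ∣ h.map (algebraMap K E) * gPoly (Fintype.card K) n α ↔ aeval φ h α = 0 := by
  rw [← X_pow_sub_one_dvd_gPoly_iff (q := Fintype.card K) Fintype.card_ne_zero hn]
  exact (dvd_iff_dvd_of_dvd_sub (X_pow_sub_one_dvd_map_mul_gPoly_sub hn hE h α))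

theorem aeval_frobenius_X_pow_sub_one {n : ℕ} (hn : n ≠ 0)
    (hE : Fintype.card E = Fintype.card K ^ n) (α : E) : aeval φ (X ^ n - 1 : K[X]) α = 0 := by
  rw [← X_pow_sub_one_dvd_map_mul_gPoly_iff hn hE]
  simp

omit [Fintype E] in
theorem mem_range_algebraMap_of_pow_card {x : E} (hx : x ^ Fintype.card K = x) :
    x ∈ Set.range (algebraMap K E) := by
  have h := congrArg (aeval x) (prod_multiset_X_sub_C_of_monic_of_roots_card_eq
    (p := (X ^ Fintype.card K - X : K[X])) (monic_X_pow_sub (by simpa using Fintype.one_lt_card))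
    (by rw [FiniteField.roots_X_pow_card_sub_X,
      FiniteField.X_pow_card_sub_X_natDegree_eq K Fintype.one_lt_card]; rfl))
  rw [FiniteField.roots_X_pow_card_sub_X] at h
  change aeval x (∏ a : K, (X - C a)) = _ at h
  rw [map_prod] at h
  simp only [map_sub, aeval_X, aeval_C, map_pow, hx, sub_self] at h
  obtain ⟨a, _, ha⟩ := Finset.prod_eq_zero_iff.1 h
  exact ⟨a, (sub_eq_zero.1 ha).symm⟩

/-- The gcd defining `k`-normality is defined over the small field. -/
theorem exists_map_eq_gcd {n : ℕ} (hn : n ≠ 0)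
    (hE : Fintype.card E = Fintype.card K ^ n) (α : E) :
    ∃ G : K[X], G.Monic ∧ Associated (G.map (algebraMap K E))
      (@EuclideanDomain.gcd (Polynomial E) _ (Classical.decEq _)
        ((X : Polynomial E) ^ n - 1) (gPoly (Fintype.card K) n α)) := by
  classical
  set D := @EuclideanDomain.gcd (Polynomial E) _ (Classical.decEq _)
        ((X : Polynomial E) ^ n - 1) (gPoly (Fintype.card K) n α) with hD
  have hX : (X ^ n - 1 : E[X]) ≠ 0 := X_pow_sub_C_ne_zero (Nat.pos_of_ne_zero hn) 1
  have hD0 : D ≠ 0 := fun h => hX (by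
    have := EuclideanDomain.gcd_dvd_left ((X : Polynomial E) ^ n - 1) (gPoly (Fintype.card K) n α)
    have h' : D ∣ X ^ n - 1 := by convert this
    exact zero_dvd_iff.1 (h ▸ h'))
  have hD1 : D ∣ X ^ n - 1 := @EuclideanDomain.gcd_dvd_left (Polynomial E) _ (Classical.decEq _) _ _
  have hD2 : D ∣ gPoly (Fintype.card K) n α :=
    @EuclideanDomain.gcd_dvd_right (Polynomial E) _ (Classical.decEq _) _ _
  have hassoc : Associated (normalize D) D := normalize_associated D
  have hmonic : (normalize D).Monic := monic_normalize hD0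
  set σ : E →+* E := (FiniteField.frobeniusAlgHom K E).toRingHom with hσ
  have hσx : ∀ x, σ x = x ^ Fintype.card K := fun x => by simp [hσ]
  have h1 : (normalize D).map σ ∣ X ^ n - 1 := by
    have := Polynomial.map_dvd σ (hassoc.dvd.trans hD1)
    simpa using this
  have h2 : (normalize D).map σ ∣ gPoly (Fintype.card K) n α := by
    have h3 := Polynomial.map_dvd σ (hassoc.dvd.trans hD2)
    have h4 : (gPoly (Fintype.card K) n α).map σ =
        gPoly (Fintype.card K) n (α ^ Fintype.card K) := by
      unfold gPoly
      rw [Polynomial.map_sum]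
      refine Finset.sum_congr rfl fun i _ => ?_
      rw [Polynomial.map_mul, map_C, Polynomial.map_pow, map_X, hσx, ← pow_mul, ← pow_mul,
        mul_comm (_ ^ i)]
    rw [h4, gPoly_pow hn (by rw [← hE, FiniteField.pow_card])] at h3
    have h5 := (dvd_sub_left (h1.mul_left (C α))).1 h3
    refine IsCoprime.dvd_of_dvd_mul_left (IsCoprime.of_isCoprime_of_dvd_left ?_ h1) h5
    obtain ⟨m, rfl⟩ := Nat.exists_eq_succ_of_ne_zero hn
    exact ⟨-1, X ^ m, by rw [pow_succ]; ring⟩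
  have h3 : (normalize D).map σ ∣ normalize D :=
    (@EuclideanDomain.dvd_gcd (Polynomial E) _ (Classical.decEq _) _ _ _ h1 h2).trans
      hassoc.symm.dvd
  have h4 : (normalize D).map σ = normalize D :=
    (eq_of_monic_of_dvd_of_natDegree_le (hmonic.map σ) hmonic h3 (by rw [natDegree_map])).symm
  have hlift : normalize D ∈ lifts (algebraMap K E) := by
    rw [lifts_iff_coeff_lifts]
    intro k
    have := congrArg (fun p => p.coeff k) h4
    simp only [coeff_map, hσx] at this
    exact mem_range_algebraMap_of_pow_card this
  obtain ⟨G, hG1, _, hG2⟩ := lifts_and_natDegree_eq_and_monic hlift hmonic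
  exact ⟨G, hG2, hG1 ▸ hassoc⟩

/-- An element with annihilator `g` is `k`-normal where `k` is the degree of `(X ^ n - 1) / g`. -/
theorem isKNormal_of_annihilator {n : ℕ} (hn : n ≠ 0)
    (hE : Fintype.card E = Fintype.card K ^ n) {f g : K[X]} (hfg : f * g = X ^ n - 1) {α : E}
    (hg : aeval φ g α = 0) (hP : ∀ P h, Irreducible P → P * h = g → aeval φ h α ≠ 0) :
    IsKNormal (Fintype.card K) n f.natDegree α := by
  classical
  unfold IsKNormal
  obtain ⟨G, hGm, hG⟩ := exists_map_eq_gcd hn hE α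
  set D := @EuclideanDomain.gcd (Polynomial E) _ (Classical.decEq _)
        ((X : Polynomial E) ^ n - 1) (gPoly (Fintype.card K) n α) with hD
  have hX : (X ^ n - 1 : K[X]) ≠ 0 := X_pow_sub_C_ne_zero (Nat.pos_of_ne_zero hn) 1
  have hf0 : f ≠ 0 := by rintro rfl; simp at hfg; exact hX hfg.symm
  have hg0 : g ≠ 0 := by rintro rfl; simp at hfg; exact hX hfg.symm
  have hmapX : (X ^ n - 1 : K[X]).map (algebraMap K E) = X ^ n - 1 := by simp
  have hD1 : D ∣ X ^ n - 1 := @EuclideanDomain.gcd_dvd_left (Polynomial E) _ (Classical.decEq _) _ _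
  have hD2 : D ∣ gPoly (Fintype.card K) n α :=
    @EuclideanDomain.gcd_dvd_right (Polynomial E) _ (Classical.decEq _) _ _
  have hfD : f.map (algebraMap K E) ∣ D := by
    refine @EuclideanDomain.dvd_gcd (Polynomial E) _ (Classical.decEq _) _ _ _ ?_ ?_
    · rw [← hmapX, ← hfg, Polynomial.map_mul]
      exact dvd_mul_right _ _
    · have := (X_pow_sub_one_dvd_map_mul_gPoly_iff hn hE g α).2 hg
      rw [← hmapX, ← hfg, Polynomial.map_mul, mul_comm] at this
      exact (mul_dvd_mul_iff_left (Polynomial.map_ne_zero hg0)).1 this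
  have hGX : G ∣ X ^ n - 1 := by
    rw [← map_dvd_map' (algebraMap K E), hmapX]
    exact hG.dvd.trans hD1
  obtain ⟨h, hh⟩ := hGX
  have hh0 : aeval φ h α = 0 := by
    rw [← X_pow_sub_one_dvd_map_mul_gPoly_iff hn hE, ← hmapX, hh, Polynomial.map_mul, mul_comm]
    exact mul_dvd_mul_left _ (hG.dvd.trans hD2)
  have hd0 : aeval φ (EuclideanDomain.gcd g h) α = 0 := by
    rw [EuclideanDomain.gcd_eq_gcd_ab, map_add, mul_comm, mul_comm h]
    simp [hg, hh0]
  obtain ⟨e, he⟩ := EuclideanDomain.gcd_dvd_left g h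
  have heu : IsUnit e := by
    by_contra hne
    have he0 : e ≠ 0 := by rintro rfl; simp at he; exact hg0 he
    obtain ⟨P, hPi, e', rfl⟩ := WfDvdMonoid.exists_irreducible_factor hne he0
    refine hP P (e' * EuclideanDomain.gcd g h) hPi (by rw [← mul_assoc, mul_comm, ← he]) ?_
    · simp [hd0]
  have hgh : g ∣ h := by
    rw [he]
    exact (heu.mul_right_dvd).2 (EuclideanDomain.gcd_dvd_right g h)
  obtain ⟨s, rfl⟩ := hgh
  have hGf : G ∣ f := ⟨s, mul_right_cancel₀ hg0 (by rw [hfg, hh]; ring)⟩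
  refine le_antisymm ?_ ?_
  · rw [← natDegree_eq_of_degree_eq (degree_eq_degree_of_associated hG), natDegree_map]
    exact natDegree_le_of_dvd hGf hf0
  · rw [← natDegree_map (algebraMap K E)]
    refine natDegree_le_of_dvd hfD ?_
    rintro h
    rw [h, zero_dvd_iff] at hD1
    exact X_pow_sub_C_ne_zero (Nat.pos_of_ne_zero hn) (1 : E) (by simpa using hD1)

end Frobenius

section Scaling

variable {K E : Type*} [Field K] [Fintype K] [Field E] [Fintype E] [Algebra K E]

/-- An element which is not an `r`-th power for any prime `r ∣ N` becomes primitive after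
multiplication by an element of the small field, where `N` is the index of the multiplicative
group of the small field. -/
theorem exists_isUnit_smul_orderOf_eq {N : ℕ}
    (hN : N * (Fintype.card K - 1) = Fintype.card E - 1) {v : E} (hv : v ≠ 0)
    (h : ∀ r, r.Prime → r ∣ N → v ^ ((Fintype.card E - 1) / r) ≠ 1) :
    ∃ c : K, c ≠ 0 ∧ orderOf (c • v) = Fintype.card E - 1 := by
  classical
  obtain ⟨ζ, hz⟩ := IsCyclic.exists_generator (α := Eˣ)
  have hζ : orderOf ζ = Fintype.card E - 1 := by
    rw [orderOf_eq_card_of_forall_mem_zpowers hz, Nat.card_eq_fintype_card, Fintype.card_units]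
  have hE : 0 < Fintype.card E - 1 := by have := Fintype.one_lt_card (α := E); omega
  have : NeZero (Fintype.card E - 1) := ⟨hE.ne'⟩
  have hN0 : N ≠ 0 := by rintro rfl; omega
  obtain ⟨a, ha⟩ := mem_powers_iff_mem_zpowers.2 (hz (Units.mk0 v hv))
  have ha' : (ζ : E) ^ a = v := by
    have := congrArg Units.val ha
    simpa using this
  have hζ' : orderOf (ζ : E) = Fintype.card E - 1 := by rw [orderOf_units, hζ]
  have hcop : a.Coprime N := by
    refine Nat.Coprime.symm (Nat.coprime_of_dvd fun r hr hrN hra => h r hr hrN ?_)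
    rw [← ha', ← pow_mul, ← orderOf_dvd_iff_pow_eq_one, hζ']
    obtain ⟨b, rfl⟩ := hra
    have h1 : r ∣ Fintype.card E - 1 := hrN.trans ⟨_, hN.symm⟩
    rw [mul_comm r, mul_assoc, Nat.mul_div_cancel' h1]
    exact dvd_mul_left _ _
  obtain ⟨u, hu⟩ := ZMod.unitsMap_surjective (show N ∣ Fintype.card E - 1 from ⟨_, hN.symm⟩)
    (ZMod.unitOfCoprime a hcop)
  have hb : (u : ZMod (Fintype.card E - 1)).val ≡ a [MOD N] := by
    rw [← ZMod.natCast_eq_natCast_iff]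
    have := congrArg Units.val hu
    rw [ZMod.unitsMap_val, ZMod.coe_unitOfCoprime] at this
    rw [← this]
    exact ZMod.natCast_val _
  set b := (u : ZMod (Fintype.card E - 1)).val with hbdef
  have hbc : b.Coprime (Fintype.card E - 1) := ZMod.val_coe_unit_coprime u
  have hc : ((ζ : E) ^ b * v⁻¹) ^ (Fintype.card K - 1) = 1 := by
    rw [mul_pow, inv_pow, ← ha', ← pow_mul, ← pow_mul]
    have : (ζ : E) ^ (b * (Fintype.card K - 1)) = (ζ : E) ^ (a * (Fintype.card K - 1)) := by
      rw [← Units.val_pow_eq_pow_val, ← Units.val_pow_eq_pow_val, Units.val_inj,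
        pow_eq_pow_iff_modEq, hζ, ← hN]
      exact Nat.ModEq.mul_right' _ hb
    rw [this]
    exact mul_inv_cancel₀ (by simp)
  obtain ⟨c, hc'⟩ := mem_range_algebraMap_of_pow_card (K := K) (x := (ζ : E) ^ b * v⁻¹) (by
    have hK := Fintype.card_pos (α := K)
    conv_lhs => rw [← Nat.sub_add_cancel hK, pow_succ, hc, one_mul])
  have hcv : c • v = (ζ : E) ^ b := by
    rw [Algebra.smul_def, hc', mul_assoc, inv_mul_cancel₀ hv, mul_one]
  refine ⟨c, ?_, ?_⟩
  · rintro rfl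
    rw [zero_smul] at hcv
    exact (pow_ne_zero b ζ.ne_zero) hcv.symm
  · rw [hcv, Nat.Coprime.orderOf_pow (by rw [hζ']; exact hbc.symm), hζ']

end Scaling

section Kernels

variable {K E : Type*} [Field K] [Fintype K] [Field E] [Fintype E] [Algebra K E]

local notation "φ" => AlgHom.toLinearMap (FiniteField.frobeniusAlgHom K E)

theorem aeval_frobenius_apply (h : K[X]) (α : E) :
    aeval φ h α = (h.sum fun i a => C (algebraMap K E a) * X ^ Fintype.card K ^ i).eval α := by
  rw [aeval_eq_sum_range, sum_over_range _ (by simp), eval_finsetSum, LinearMap.sum_apply]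
  refine Finset.sum_congr rfl fun i _ => ?_
  have : (φ ^ i : E →ₗ[K] E) α = α ^ Fintype.card K ^ i := by
    clear * -
    induction i with
    | zero => simp
    | succ i ih =>
      rw [pow_succ', Module.End.mul_apply, ih, pow_succ, pow_mul]
      simp
  rw [LinearMap.smul_apply, this, Algebra.smul_def]
  simp

theorem natCard_ker_aeval_frobenius_le {h : K[X]} (hh : h ≠ 0) :
    Nat.card (LinearMap.ker (aeval φ h : E →ₗ[K] E)) ≤ Fintype.card K ^ h.natDegree := by
  classical
  have hq := Fintype.one_lt_card (α := K)
  set L : E[X] := h.sum fun i a => C (algebraMap K E a) * X ^ Fintype.card K ^ i with hL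
  have hcoeff : L.coeff (Fintype.card K ^ h.natDegree) = algebraMap K E h.leadingCoeff := by
    rw [hL, sum_over_range _ (by simp), finsetSum_coeff, Finset.sum_eq_single h.natDegree]
    · simp
    · intro i _ hi
      rw [coeff_C_mul_X_pow, if_neg fun h' => hi (Nat.pow_right_injective hq h').symm]
    · simp
  have hL0 : L ≠ 0 := by
    intro h0
    rw [h0, coeff_zero] at hcoeff
    exact hh (leadingCoeff_eq_zero.1 ((map_eq_zero _).1 hcoeff.symm))
  have hdeg : L.natDegree ≤ Fintype.card K ^ h.natDegree := by
    rw [hL, sum_over_range _ (by simp)]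
    refine natDegree_sum_le_of_forall_le _ _ fun i hi => (natDegree_C_mul_X_pow_le _ _).trans ?_
    exact Nat.pow_le_pow_right hq.le (by simpa [Nat.lt_succ_iff] using hi)
  refine le_trans ?_ ((card_roots' L).trans hdeg)
  have hinj : Nat.card (LinearMap.ker (aeval φ h : E →ₗ[K] E)) ≤ L.roots.toFinset.card := by
    rw [← Nat.card_eq_finsetCard]
    refine Nat.card_le_card_of_injective
      (fun x => (⟨x.1, ?_⟩ : L.roots.toFinset)) ?_
    · have := x.2
      rw [LinearMap.mem_ker, aeval_frobenius_apply, ← hL] at this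
      simp [hL0, this]
    · intro x y hxy
      exact Subtype.ext (Subtype.mk.inj hxy)
  exact hinj.trans (Multiset.toFinset_card_le _)

theorem natCard_ker_aeval_frobenius {n : ℕ} (hn : n ≠ 0)
    (hE : Fintype.card E = Fintype.card K ^ n) {h k : K[X]} (hk : h * k = X ^ n - 1) :
    Nat.card (LinearMap.ker (aeval φ h : E →ₗ[K] E)) = Fintype.card K ^ h.natDegree := by
  have hq := Fintype.one_lt_card (α := K)
  have hX : (X ^ n - 1 : K[X]) ≠ 0 := X_pow_sub_C_ne_zero (Nat.pos_of_ne_zero hn) 1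
  have hh0 : h ≠ 0 := by rintro rfl; simp at hk; exact hX hk.symm
  have hk0 : k ≠ 0 := by rintro rfl; simp at hk; exact hX hk.symm
  have hdeg : h.natDegree + k.natDegree = n := by
    rw [← natDegree_mul hh0 hk0, hk]
    exact natDegree_X_pow_sub_C (r := (1 : K))
  refine le_antisymm (natCard_ker_aeval_frobenius_le hh0) ?_
  have hr : LinearMap.range (aeval φ h : E →ₗ[K] E) ≤ LinearMap.ker (aeval φ k : E →ₗ[K] E) := by
    rintro _ ⟨x, rfl⟩
    rw [LinearMap.mem_ker, ← Module.End.mul_apply, ← map_mul, mul_comm, hk]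
    exact aeval_frobenius_X_pow_sub_one hn hE x
  have h1 := natCard_ker_aeval_frobenius_le (E := E) hk0
  rw [Module.natCard_eq_pow_finrank (K := K), Nat.card_eq_fintype_card] at h1 ⊢
  have h2 := (Nat.pow_le_pow_iff_right hq).1 h1
  have h3 := Submodule.finrank_mono hr
  have h4 := LinearMap.finrank_range_add_finrank_ker (aeval φ h : E →ₗ[K] E)
  have h5 : Module.finrank K E = n := by
    have := Module.card_eq_pow_finrank (K := K) (V := E)
    exact Nat.pow_right_injective hq (this.symm.trans hE)
  exact Nat.pow_le_pow_right hq.le (by omega)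

open Classical in
theorem exists_primitive_isKNormal {n N : ℕ} (hn : n ≠ 0)
    (hE : Fintype.card E = Fintype.card K ^ n)
    (hN : N * (Fintype.card K - 1) = Fintype.card E - 1)
    {f g : K[X]} (hfg : f * g = X ^ n - 1) (C S : Finset ℕ) (hCS : Disjoint C S)
    (hprime : ∀ r, r ∈ C ∪ S ↔ r.Prime ∧ r ∣ N)
    (hineq : 2 ^ C.card *
        (1 + S.card + (UniqueFactorizationMonoid.normalizedFactors g).toFinset.card : ℝ) *
        √(Fintype.card E) <
      Fintype.card K ^ g.natDegree * (1 - ∑ p ∈ S, 1 / (p : ℝ) -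
        ∑ P ∈ (UniqueFactorizationMonoid.normalizedFactors g).toFinset,
          1 / (Fintype.card K : ℝ) ^ P.natDegree)) :
    ∃ α : E, orderOf α = Fintype.card E - 1 ∧ IsKNormal (Fintype.card K) n f.natDegree α := by
  have hX : (X ^ n - 1 : K[X]) ≠ 0 := X_pow_sub_C_ne_zero (Nat.pos_of_ne_zero hn) 1
  have hg0 : g ≠ 0 := by rintro rfl; simp at hfg; exact hX hfg.symm
  have hK0 : (0 : ℝ) < Fintype.card K := by exact_mod_cast Fintype.card_pos
  have hdiv : ∀ P ∈ (UniqueFactorizationMonoid.normalizedFactors g).toFinset, P * (g / P) = g :=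
    fun P hP => EuclideanDomain.mul_div_cancel'
      (UniqueFactorizationMonoid.ne_zero_of_mem_normalizedFactors (Multiset.mem_toFinset.1 hP))
      (UniqueFactorizationMonoid.dvd_of_mem_normalizedFactors (Multiset.mem_toFinset.1 hP))
  obtain ⟨v, hvV, hv0, hvU, hvp⟩ := exists_mem_of_sieve
    (LinearMap.ker (aeval φ g : E →ₗ[K] E)).toAddSubgroup
    (UniqueFactorizationMonoid.normalizedFactors g).toFinset
    (fun P => (LinearMap.ker (aeval φ (g / P) : E →ₗ[K] E)).toAddSubgroup) C S hCS
    (fun r hr => ⟨((hprime r).1 hr).1, ((hprime r).1 hr).2.trans ⟨_, hN.symm⟩⟩) (by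
      refine hineq.trans_eq ?_
      have h1 : Nat.card (LinearMap.ker (aeval φ g : E →ₗ[K] E)).toAddSubgroup =
          Fintype.card K ^ g.natDegree :=
        natCard_ker_aeval_frobenius (E := E) hn hE (h := g) (k := f) (by rw [mul_comm, hfg])
      have h2 : ∀ P ∈ (UniqueFactorizationMonoid.normalizedFactors g).toFinset,
          (Nat.card (LinearMap.ker (aeval φ (g / P) : E →ₗ[K] E)).toAddSubgroup : ℝ) =
          Fintype.card K ^ g.natDegree * (1 / (Fintype.card K : ℝ) ^ P.natDegree) := fun P hP => by
        have h3 := hdiv P hP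
        have h4 : Nat.card (LinearMap.ker (aeval φ (g / P) : E →ₗ[K] E)).toAddSubgroup =
            Fintype.card K ^ (g / P).natDegree :=
          natCard_ker_aeval_frobenius (E := E) hn hE (h := g / P) (k := P * f)
            (by rw [← mul_assoc, mul_comm (g / P), h3, mul_comm, hfg])
        have hP0 : P ≠ 0 := by rintro rfl; simp at h3; exact hg0 h3.symm
        have hQ0 : g / P ≠ 0 := by intro h0; simp [h0] at h3; exact hg0 h3.symm
        have h5 : g.natDegree = P.natDegree + (g / P).natDegree := by
          rw [← natDegree_mul hP0 hQ0, h3]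
        rw [h4, h5, pow_add]
        push_cast
        field_simp
      rw [h1, Finset.sum_congr rfl h2, ← Finset.mul_sum]
      push_cast
      ring)
  obtain ⟨c, hc0, hc⟩ := exists_isUnit_smul_orderOf_eq hN hv0
    fun r hr hrN => hvp r ((hprime r).2 ⟨hr, hrN⟩)
  refine ⟨c • v, hc, isKNormal_of_annihilator hn hE hfg ?_ fun P h hP hPh h0 => ?_⟩
  · rw [map_smul]
    have : aeval φ g v = 0 := hvV
    rw [this, smul_zero]
  · rw [map_smul, smul_eq_zero_iff_right hc0] at h0
    obtain ⟨P', hP', u, hu⟩ := UniqueFactorizationMonoid.exists_mem_normalizedFactors_of_dvd hg0 hP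
      ⟨h, hPh.symm⟩
    have hP'' := Multiset.mem_toFinset.2 hP'
    refine hvU P' hP'' ?_
    change aeval φ (g / P') v = 0
    have h1 := hdiv P' hP''
    have h2 : g / P' = ((u⁻¹ : K[X]ˣ) : K[X]) * h := by
      have hP0 : P' ≠ 0 := UniqueFactorizationMonoid.ne_zero_of_mem_normalizedFactors hP'
      refine mul_left_cancel₀ hP0 ?_
      rw [h1, ← hu, mul_assoc, ← mul_assoc (u : K[X]), Units.mul_inv, one_mul, hPh]
    rw [h2, map_mul, Module.End.mul_apply, h0, map_zero]

end Kernels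

section Factors

variable {K : Type*} [Field K] [Fintype K]

open UniqueFactorizationMonoid

theorem natCast_ne_zero_of_coprime_card {n : ℕ} (h : n.Coprime (Fintype.card K)) :
    (n : K) ≠ 0 := by
  obtain ⟨p, hp⟩ := CharP.exists K
  have : p.Prime := (CharP.char_is_prime_or_zero K p).resolve_right
    (CharP.char_ne_zero_of_finite K p)
  rw [Ne, CharP.cast_eq_zero_iff K p]
  intro hpn
  have hpq : p ∣ Fintype.card K := (CharP.cast_eq_zero_iff K p _).1 (Nat.cast_card_eq_zero K)
  exact this.one_lt.ne' (Nat.eq_one_of_dvd_coprimes h hpn hpq)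

theorem exists_charP_card_eq_pow (K : Type*) [Field K] [Fintype K] :
    ∃ (p : ℕ) (_ : CharP K p) (k : ℕ), p.Prime ∧ Fintype.card K = p ^ k := by
  obtain ⟨p, hp⟩ := CharP.exists K
  obtain ⟨k, hp', hk⟩ := FiniteField.card K p
  exact ⟨p, hp, k, hp', hk⟩

theorem card_roots_X_pow_sub_one_le {n : ℕ} (hn : n ≠ 0) (s : Finset K)
    (hs : ∀ x ∈ s, x ^ n = 1) : s.card ≤ Nat.gcd n (Fintype.card K - 1) := by
  classical
  have ha : 0 < Nat.gcd n (Fintype.card K - 1) := Nat.gcd_pos_of_pos_left _ (Nat.pos_of_ne_zero hn)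
  refine le_trans (Finset.card_le_card
    (t := nthRootsFinset (Nat.gcd n (Fintype.card K - 1)) (1 : K)) fun x hx => ?_) ?_
  · rw [mem_nthRootsFinset ha]
    have h1 := hs x hx
    have hx0 : x ≠ 0 := by
      rintro rfl
      simp [hn] at h1
    exact pow_gcd_eq_one.2 ⟨h1, FiniteField.pow_card_sub_one_eq_one x hx0⟩
  · rw [nthRootsFinset]
    exact (Multiset.toFinset_card_le _).trans (card_nthRoots _ _)

omit [Fintype K] in
open Classical in
theorem card_linear_normalizedFactors_le {g : K[X]} (hg : g ≠ 0) :
    ((normalizedFactors g).toFinset.filter fun P => P.natDegree = 1).card ≤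
      g.roots.toFinset.card := by
  have hroot : ∀ P ∈ (normalizedFactors g).toFinset.filter fun P => P.natDegree = 1,
      P = X - C (-P.coeff 0) := by
    intro P hP
    rw [Finset.mem_filter, Multiset.mem_toFinset] at hP
    have hm : P.Monic := by
      have := monic_normalize (ne_zero_of_mem_normalizedFactors hP.1)
      rwa [normalize_normalized_factor P hP.1] at this
    rw [C_neg, sub_neg_eq_add]
    exact hm.eq_X_add_C hP.2
  refine Finset.card_le_card_of_injOn (fun P => -P.coeff 0) (fun P hP => ?_) ?_
  · have h1 := hroot P hP
    have hd : P ∣ g := dvd_of_mem_normalizedFactors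
      (Multiset.mem_toFinset.1 (Finset.mem_filter.1 hP).1)
    simp only [Finset.mem_coe, Multiset.mem_toFinset]
    rw [mem_roots hg, ← dvd_iff_isRoot, ← h1]
    exact hd
  · intro P hP Q hQ h
    rw [hroot P hP, hroot Q hQ]
    simp only at h
    rw [h]

omit [Fintype K] in
open Classical in
theorem sum_natDegree_normalizedFactors_le {g : K[X]} (hg : g ≠ 0) :
    ∑ P ∈ (normalizedFactors g).toFinset, P.natDegree ≤ g.natDegree := by
  have h1 : g.natDegree = ((normalizedFactors g).map natDegree).sum := by
    rw [← natDegree_multiset_prod _ (zero_notMem_normalizedFactors g)]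
    exact natDegree_eq_of_degree_eq
      (degree_eq_degree_of_associated (prod_normalizedFactors hg).symm)
  rw [h1, Finset.sum_multiset_map_count]
  refine Finset.sum_le_sum fun P hP => ?_
  have := Multiset.count_pos.2 (Multiset.mem_toFinset.1 hP)
  rw [smul_eq_mul]
  exact Nat.le_mul_of_pos_left _ this

/-- An upper bound for the number of linear factors of the annihilator. -/
def linearBound (q n : ℕ) : ℕ :=
  if Nat.gcd n q = 1 ∧ 2 ≤ Nat.gcd n (q - 1) then Nat.gcd n (q - 1) - 2 else Nat.gcd n (q - 1)

omit [Fintype K] in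
theorem roots_subset_of_mul_eq {n : ℕ} {f g : K[X]} (hfg : f * g = X ^ n - 1) {x : K}
    (hx : g.IsRoot x) : x ^ n = 1 := by
  have := congrArg (eval x) hfg
  rw [eval_mul, hx.eq_zero] at this
  simp at this
  exact (sub_eq_zero.1 this.symm)

open Classical in
theorem exists_quadratic_factor {n : ℕ} (hn : n ≠ 0)
    (h : Nat.gcd (Fintype.card K ^ 3 - Fintype.card K) n ≠ 1) :
    ∃ f g : K[X], f * g = X ^ n - 1 ∧ f.natDegree = 2 ∧
      g.roots.toFinset.card ≤ linearBound (Fintype.card K) n := by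
  have hX : (X ^ n - 1 : K[X]) ≠ 0 := X_pow_sub_C_ne_zero (Nat.pos_of_ne_zero hn) 1
  have hgen : ∀ f g : K[X], f * g = X ^ n - 1 →
      g.roots.toFinset.card ≤ Nat.gcd n (Fintype.card K - 1) := by
    intro f g hfg
    refine card_roots_X_pow_sub_one_le hn _ fun x hx => ?_
    rw [Multiset.mem_toFinset] at hx
    exact roots_subset_of_mul_eq hfg (isRoot_of_mem_roots hx)
  have hq := Fintype.one_lt_card (α := K)
  unfold linearBound
  by_cases hnq : Nat.gcd n (Fintype.card K) = 1
  · have hn0 : (n : K) ≠ 0 := natCast_ne_zero_of_coprime_card hnq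
    by_cases ha : 2 ≤ Nat.gcd n (Fintype.card K - 1)
    · rw [if_pos ⟨hnq, ha⟩]
      set a := Nat.gcd n (Fintype.card K - 1) with hadef
      obtain ⟨ζ, hz⟩ := IsCyclic.exists_generator (α := Kˣ)
      have hζ : orderOf ζ = Fintype.card K - 1 := by
        rw [orderOf_eq_card_of_forall_mem_zpowers hz, Nat.card_eq_fintype_card, Fintype.card_units]
      obtain ⟨b, hb⟩ : a ∣ Fintype.card K - 1 := Nat.gcd_dvd_right _ _
      have hb0 : 0 < b := Nat.pos_of_ne_zero (by rintro rfl; omega)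
      obtain ⟨d, hd⟩ : a ∣ n := Nat.gcd_dvd_left _ _
      set z : K := (ζ : K) ^ b with hzdef
      have hzn : z ^ n = 1 := by
        rw [hzdef, hd, ← pow_mul, ← mul_assoc, mul_comm b, ← hb, pow_mul,
          FiniteField.pow_card_sub_one_eq_one _ ζ.ne_zero, one_pow]
      have hz1 : z ≠ 1 := by
        intro h1
        have h2 : ζ ^ b = 1 := Units.ext (by simpa using h1)
        have h3 := Nat.le_of_dvd hb0 (orderOf_dvd_of_pow_eq_one h2)
        rw [hζ, hb] at h3
        nlinarith
      have hc : IsCoprime (X - C 1 : K[X]) (X - C z) := isCoprime_X_sub_C_of_isUnit_sub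
        (isUnit_iff_ne_zero.2 (sub_ne_zero.2 hz1.symm))
      obtain ⟨g, hg⟩ : (X - C 1) * (X - C z) ∣ (X ^ n - 1 : K[X]) := by
        refine hc.mul_dvd ?_ ?_ <;> rw [dvd_iff_isRoot] <;> simp [hzn]
      refine ⟨_, g, hg.symm, ?_, ?_⟩
      · rw [natDegree_mul (X_sub_C_ne_zero _) (X_sub_C_ne_zero _), natDegree_X_sub_C,
          natDegree_X_sub_C]
      · have hnr : ∀ x, (x = 1 ∨ x = z) → x ∉ g.roots.toFinset := by
          intro x hx hxr
          have hgx : g.eval x = 0 := isRoot_of_mem_roots (Multiset.mem_toFinset.1 hxr)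
          have hxn := roots_subset_of_mul_eq hg.symm hgx
          have h1 := congrArg (fun p => eval x (derivative p)) hg
          have hx0 : x ≠ 0 := by rintro rfl; simp [hn] at hxn
          have : (n : K) * x ^ (n - 1) = 0 := by
            rcases hx with rfl | rfl <;> simpa [hgx, derivative_X_pow] using h1
          exact mul_ne_zero hn0 (pow_ne_zero _ hx0) this
        have := card_roots_X_pow_sub_one_le hn (insert 1 (insert z g.roots.toFinset)) (by
          intro x hx
          rw [Finset.mem_insert, Finset.mem_insert] at hx
          rcases hx with rfl | rfl | hx
          · simp
          · exact hzn
          · exact roots_subset_of_mul_eq hg.symm (isRoot_of_mem_roots (Multiset.mem_toFinset.1 hx)))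
        rw [Finset.card_insert_of_notMem, Finset.card_insert_of_notMem (hnr z (Or.inr rfl))] at this
        · omega
        · rw [Finset.mem_insert, not_or]
          exact ⟨hz1.symm, hnr 1 (Or.inl rfl)⟩
    · rw [if_neg fun h => ha h.2]
      obtain ⟨r, hr, hrd⟩ := Nat.exists_prime_and_dvd h
      have hrn : r ∣ n := hrd.trans (Nat.gcd_dvd_right _ _)
      have hrq : r ∣ Fintype.card K ^ 3 - Fintype.card K := hrd.trans (Nat.gcd_dvd_left _ _)
      have hrK : ¬ r ∣ Fintype.card K := fun h' =>
        hr.one_lt.ne' (Nat.eq_one_of_dvd_coprimes hnq hrn h')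
      have hrK1 : ¬ r ∣ Fintype.card K - 1 := fun h' => by
        have := Nat.le_of_dvd (Nat.gcd_pos_of_pos_left _ (Nat.pos_of_ne_zero hn))
          (Nat.dvd_gcd hrn h')
        have := hr.two_le
        omega
      have hrK2 : r ∣ Fintype.card K ^ 2 - 1 := by
        have : Fintype.card K ^ 3 - Fintype.card K = Fintype.card K * (Fintype.card K ^ 2 - 1) := by
          rw [Nat.mul_sub, mul_one]; ring_nf
        rw [this] at hrq
        exact (hr.dvd_mul.1 hrq).resolve_left hrK
      obtain ⟨p, hp, k, hpp, hk⟩ := exists_charP_card_eq_pow K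
      have : Fact p.Prime := ⟨hpp⟩
      have hrp : p.Coprime r := (Nat.coprime_primes hpp hr).2 (by
        rintro rfl
        exact hrK ((CharP.cast_eq_zero_iff K p _).1 (Nat.cast_card_eq_zero K)))
      obtain ⟨P, hPi, hPd⟩ := WfDvdMonoid.exists_irreducible_factor (a := cyclotomic r K)
        (not_isUnit_of_degree_pos _ (degree_cyclotomic_pos r K hr.pos)) (cyclotomic_ne_zero r K)
      have hdeg := natDegree_of_dvd_cyclotomic_of_irreducible hk hrp hPd hPi
      obtain ⟨g, hg⟩ : P ∣ X ^ n - 1 :=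
        hPd.trans ((cyclotomic.dvd_X_pow_sub_one r K).trans (by
          obtain ⟨m, rfl⟩ := hrn
          simpa [pow_mul] using sub_dvd_pow_sub_pow (X ^ r : K[X]) 1 m))
      refine ⟨P, g, hg.symm, ?_, hgen _ _ hg.symm⟩
      have : Fact (Nat.Prime 2) := ⟨Nat.prime_two⟩
      rw [hdeg]
      have hone : ∀ m, (ZMod.unitOfCoprime _ (hrp.pow_left k)) ^ m = 1 ↔
          r ∣ Fintype.card K ^ m - 1 := by
        intro m
        rw [← Units.val_inj, Units.val_pow_eq_pow_val, ZMod.coe_unitOfCoprime, ← hk, Units.val_one,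
          ← (Nat.modEq_iff_dvd' (Nat.one_le_pow _ _ (by omega))), ← ZMod.natCast_eq_natCast_iff]
        push_cast
        exact eq_comm
      refine orderOf_eq_prime ((hone 2).2 hrK2) fun h1 => hrK1 ?_
      simpa using (hone 1).1 (by rw [pow_one, h1])
  · rw [if_neg fun h => hnq h.1]
    obtain ⟨r, hr, hrd⟩ := Nat.exists_prime_and_dvd hnq
    have hrn : r ∣ n := hrd.trans (Nat.gcd_dvd_left _ _)
    have hrq : r ∣ Fintype.card K := hrd.trans (Nat.gcd_dvd_right _ _)
    obtain ⟨p, hp, k, hpp, hk⟩ := exists_charP_card_eq_pow K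
    have : Fact r.Prime := ⟨hr⟩
    obtain rfl : r = p := (Nat.prime_dvd_prime_iff_eq hr hpp).1 (hr.dvd_of_dvd_pow (hk ▸ hrq))
    obtain ⟨m, rfl⟩ := hrn
    have h1 : (X ^ (r * m) - 1 : K[X]) = (X ^ m - 1) ^ r := by
      rw [sub_pow_char, one_pow, ← pow_mul, mul_comm]
    have h2 : (X - C 1) ^ 2 ∣ (X ^ (r * m) - 1 : K[X]) := by
      rw [h1]
      refine (pow_dvd_pow _ hr.two_le).trans (pow_dvd_pow_of_dvd ?_ r)
      rw [dvd_iff_isRoot]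
      simp
    obtain ⟨g, hg⟩ := h2
    refine ⟨_, g, hg.symm, ?_, hgen _ _ hg.symm⟩
    rw [natDegree_pow, natDegree_X_sub_C]

open Classical in
/-- The number of distinct irreducible factors of `g`, and the sum of the inverses of their norms,
in terms of a bound for the number of roots. -/
theorem factor_bounds {g : K[X]} (hg : g ≠ 0) {T : ℕ} (hT : g.roots.toFinset.card ≤ T) :
    (normalizedFactors g).toFinset.card ≤ T + (g.natDegree - T) / 2 ∧
    ∑ P ∈ (normalizedFactors g).toFinset, 1 / (Fintype.card K : ℝ) ^ P.natDegree ≤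
      T / Fintype.card K + ((g.natDegree - T) / 2 : ℕ) / (Fintype.card K : ℝ) ^ 2 := by
  have hq : (1 : ℝ) < Fintype.card K := by exact_mod_cast Fintype.one_lt_card
  set q : ℝ := ((Fintype.card K : ℕ) : ℝ) with hqdef
  set J := (normalizedFactors g).toFinset with hJ
  set j₁ := (J.filter fun P => P.natDegree = 1).card with hj1
  set j₂ := (J.filter fun P => ¬ P.natDegree = 1).card with hj2
  have hpos : ∀ P ∈ J, 0 < P.natDegree := fun P hP =>
    (irreducible_of_normalized_factor P (Multiset.mem_toFinset.1 hP)).natDegree_pos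
  have h1 : j₁ ≤ T := (card_linear_normalizedFactors_le hg).trans hT
  have h12 : j₁ + j₂ = J.card := Finset.card_filter_add_card_filter_not _
  have hdeg : j₁ + 2 * j₂ ≤ g.natDegree := by
    refine le_trans ?_ (sum_natDegree_normalizedFactors_le hg)
    rw [← Finset.sum_filter_add_sum_filter_not J (fun P => P.natDegree = 1)]
    refine add_le_add ?_ ?_
    · have := Finset.card_nsmul_le_sum (J.filter fun P => P.natDegree = 1) natDegree 1
        (fun P hP => (Finset.mem_filter.1 hP).2.ge)
      simpa using this
    · have := Finset.card_nsmul_le_sum (J.filter fun P => ¬ P.natDegree = 1) natDegree 2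
        (fun P hP => by
          have h := Finset.mem_filter.1 hP
          have := hpos P h.1
          have := h.2
          omega)
      rw [smul_eq_mul, mul_comm] at this
      exact this
  have h2 : j₂ ≤ (g.natDegree - T) / 2 + (T - j₁) := by omega
  refine ⟨by omega, ?_⟩
  have hsum : ∑ P ∈ J, 1 / q ^ P.natDegree ≤ j₁ * (1 / q) + j₂ * (1 / q ^ 2) := by
    rw [← Finset.sum_filter_add_sum_filter_not J (fun P => P.natDegree = 1)]
    refine add_le_add ?_ ?_
    · rw [← nsmul_eq_mul]
      refine Finset.sum_le_card_nsmul _ _ _ fun P hP => ?_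
      rw [(Finset.mem_filter.1 hP).2, pow_one]
    · rw [← nsmul_eq_mul]
      refine Finset.sum_le_card_nsmul _ _ _ fun P hP => ?_
      have h := Finset.mem_filter.1 hP
      have h3 := hpos P h.1
      have h4 := h.2
      exact one_div_le_one_div_of_le (by positivity) (pow_le_pow_right₀ hq.le (by omega))
  refine hsum.trans ?_
  have h2' : (j₂ : ℝ) ≤ ((g.natDegree - T) / 2 : ℕ) + (T - j₁) := by
    rw [← Nat.cast_sub h1]
    exact_mod_cast h2
  have h5 : 1 / q ^ 2 ≤ 1 / q :=
    one_div_le_one_div_of_le (by linarith) (by nlinarith)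
  have h6 : (0 : ℝ) ≤ T - j₁ := by rw [← Nat.cast_sub h1]; positivity
  have h7 : 0 ≤ 1 / q ^ 2 := by positivity
  rw [div_eq_mul_one_div (T : ℝ), div_eq_mul_one_div (((g.natDegree - T) / 2 : ℕ) : ℝ)]
  nlinarith [mul_le_mul_of_nonneg_right h2' h7, mul_le_mul_of_nonneg_left h5 h6]

end Factors

section Existence

/-- The prime sieve with core `C` and sieving primes `S` succeeds. -/
def SieveSucceeds (q n : ℕ) (C S : Finset ℕ) : Prop :=
  2 ^ C.card * (1 + S.card + (linearBound q n + (n - 2 - linearBound q n) / 2 : ℕ) : ℝ) *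
      √((q : ℝ) ^ n) <
    (q : ℝ) ^ (n - 2) * (1 - ∑ p ∈ S, 1 / (p : ℝ) -
      (linearBound q n / q + ((n - 2 - linearBound q n) / 2 : ℕ) / (q : ℝ) ^ 2))

/-- A field with `q ^ n` elements contains a field with `q` elements. -/
theorem exists_subfield_card_eq {q n : ℕ} (hq : IsPrimePow q) (hn : n ≠ 0) (E : Type*) [Field E]
    [Fintype E] (hE : Fintype.card E = q ^ n) :
    ∃ (K : Type) (_ : Field K) (_ : Fintype K), Nonempty (Algebra K E) ∧ Fintype.card K = q := by
  obtain ⟨p, k, hp, hk, rfl⟩ := hq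
  have hp := hp.nat_prime
  have : Fact p.Prime := ⟨hp⟩
  obtain ⟨p', hp', k', hpp', hk'⟩ := exists_charP_card_eq_pow E
  have hpE : p ∣ Fintype.card E := hE ▸ dvd_pow (dvd_pow_self p hk.ne') hn
  obtain rfl : p = p' := (Nat.prime_dvd_prime_iff_eq hp hpp').1 (hp.dvd_of_dvd_pow (hk' ▸ hpE))
  have hkk : k' = k * n := Nat.pow_right_injective hp.two_le
    (show p ^ k' = p ^ (k * n) by rw [← hk', hE, pow_mul])
  let : Algebra (ZMod p) E := ZMod.algebra E p
  have : Fintype (GaloisField p k) := Fintype.ofFinite _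
  have hfE : Module.finrank (ZMod p) E = k' := by
    have := Module.card_eq_pow_finrank (K := ZMod p) (V := E)
    rw [hk', ZMod.card] at this
    exact (Nat.pow_right_injective hp.two_le this).symm
  obtain ⟨i⟩ := FiniteField.nonempty_algHom_of_finrank_dvd (F := ZMod p) (K := GaloisField p k)
    (L := E) (by rw [hfE, hkk, GaloisField.finrank p hk.ne']; exact dvd_mul_right _ _)
  refine ⟨GaloisField p k, inferInstance, inferInstance, ⟨i.toRingHom.toAlgebra⟩, ?_⟩
  rw [← Nat.card_eq_fintype_card, GaloisField.card p k hk.ne']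

open Classical in
theorem exists_primitive_of_sieveSucceeds {q n : ℕ} (hq : IsPrimePow q) (hn : n ≠ 0)
    (h : Nat.gcd (q ^ 3 - q) n ≠ 1) (C S : Finset ℕ) (hCS : Disjoint C S)
    (hprime : ∀ r, r ∈ C ∪ S ↔ r.Prime ∧ r ∣ (q ^ n - 1) / (q - 1))
    (hs : SieveSucceeds q n C S)
    {E : Type*} [Field E] [Fintype E] (hE : Fintype.card E = q ^ n) :
    ∃ α : E, IsPrimitiveElem α ∧ IsKNormal q n 2 α := by
  obtain ⟨K, _, _, ⟨_⟩, hK⟩ := exists_subfield_card_eq hq hn E hE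
  subst hK
  have hq1 : 1 < Fintype.card K := Fintype.one_lt_card
  obtain ⟨f, g, hfg, hf, hg⟩ := exists_quadratic_factor (K := K) hn h
  have hX : (X ^ n - 1 : K[X]) ≠ 0 := X_pow_sub_C_ne_zero (Nat.pos_of_ne_zero hn) 1
  have hf0 : f ≠ 0 := by rintro rfl; simp at hfg; exact hX hfg.symm
  have hg0 : g ≠ 0 := by rintro rfl; simp at hfg; exact hX hfg.symm
  have hdeg : g.natDegree = n - 2 := by
    have h1 : f.natDegree + g.natDegree = n := by
      rw [← natDegree_mul hf0 hg0, hfg]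
      exact natDegree_X_pow_sub_C (r := (1 : K))
    omega
  obtain ⟨hb1, hb2⟩ := factor_bounds hg0 hg
  rw [hdeg] at hb1 hb2
  have hN : (Fintype.card K ^ n - 1) / (Fintype.card K - 1) * (Fintype.card K - 1) =
      Fintype.card E - 1 := by
    rw [hE]
    exact Nat.div_mul_cancel (by simpa using Nat.sub_dvd_pow_sub_pow (Fintype.card K) 1 n)
  rw [← hf]
  refine exists_primitive_isKNormal hn hE hN hfg C S hCS hprime ?_
  unfold SieveSucceeds at hs
  rw [hE, hdeg]
  push_cast
  refine lt_of_le_of_lt ?_ (hs.trans_le ?_)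
  · have : ((UniqueFactorizationMonoid.normalizedFactors g).toFinset.card : ℝ) ≤
        (linearBound (Fintype.card K) n + (n - 2 - linearBound (Fintype.card K) n) / 2 : ℕ) := by
      exact_mod_cast hb1
    gcongr
  · gcongr

end Existence

section SieveCheck

/-- The primes treated individually by `sieveCheck`. -/
def sievePrimes : List ℕ :=
  [2, 3, 5, 7, 11, 13, 17, 19, 23, 29, 31, 37, 41, 43, 47, 53, 59, 61, 151, 331, 1321]

/-- An executable sufficient condition for the prime sieve to succeed, whose core consists of the
primes of `sievePrimes` up to `y`. -/
def sieveCheck (q n y : ℕ) : Bool :=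
  let N := (q ^ n - 1) / (q - 1)
  let R := N / Nat.gcd N (sievePrimes.prod ^ 7)
  let k := Nat.log2 R / 6
  let D := sievePrimes.filter fun r => N % r == 0
  let C := D.filter fun r => Nat.ble r y
  let S := D.filter fun r => !Nat.ble r y
  let T := 10 ^ 6
  let t₁ := linearBound q n
  let t₂ := (n - 2 - t₁) / 2
  let l := k * (T / 64 + 1) + t₁ * (T / q + 1) + t₂ * (T / q ^ 2 + 1) +
    (S.map fun r => T / r + 1).sum
  Nat.blt l T && Nat.blt ((2 ^ C.length * (1 + S.length + k + t₁ + t₂) * T) ^ 2)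
    (q ^ (n - 4) * (T - l) ^ 2)

theorem div_le_natDiv_add_one (T r : ℕ) : (T : ℝ) / r ≤ (T / r + 1 : ℕ) := by
  rcases Nat.eq_zero_or_pos r with rfl | hr
  · simp
  · rw [div_le_iff₀ (by exact_mod_cast hr)]
    have := (Nat.lt_div_mul_add hr (a := T)).le
    have h2 : T ≤ (T / r + 1) * r := by rw [add_mul, one_mul]; exact this
    exact_mod_cast h2

theorem mem_sievePrimes_of_lt {r : ℕ} (hr : r.Prime) (h : r < 64) : r ∈ sievePrimes := by
  revert hr
  unfold sievePrimes
  interval_cases r <;> first | simp; done | (intro h; revert h; norm_num)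

theorem prime_of_mem_sievePrimes : ∀ r ∈ sievePrimes, r.Prime := by
  unfold sievePrimes
  simp only [List.forall_mem_cons]
  norm_num

theorem nodup_sievePrimes : sievePrimes.Nodup := by decide

/-- The number of prime divisors of `N` outside `sievePrimes`. -/
theorem card_primeFactors_sdiff_le {N : ℕ} (hN : N ≠ 0) :
    (N.primeFactors \ sievePrimes.toFinset).card ≤
      Nat.log2 (N / Nat.gcd N (sievePrimes.prod ^ 7)) / 6 := by
  set B := N.primeFactors \ sievePrimes.toFinset with hB
  have hmem : ∀ r ∈ B, r.Prime ∧ r ∣ N ∧ r ∉ sievePrimes := fun r hr => by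
    rw [hB, Finset.mem_sdiff, Nat.mem_primeFactors, List.mem_toFinset] at hr
    exact ⟨hr.1.1, hr.1.2.1, hr.2⟩
  have hdvd : ∏ r ∈ B, r ∣ N := by
    refine (Finset.prod_dvd_prod_of_subset _ _ _ Finset.sdiff_subset).trans ?_
    exact Nat.prod_primeFactors_dvd N
  have hcop : (∏ r ∈ B, r).Coprime (Nat.gcd N (sievePrimes.prod ^ 7)) := by
    refine Nat.Coprime.coprime_dvd_right (Nat.gcd_dvd_right _ _) (Nat.Coprime.pow_right _ ?_)
    refine Nat.Coprime.prod_left fun r hr => ?_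
    refine Nat.coprime_list_prod_right_iff.2 fun s hs => ?_
    refine (Nat.coprime_primes (hmem r hr).1 (prime_of_mem_sievePrimes s hs)).2 ?_
    rintro rfl
    exact (hmem r hr).2.2 hs
  have hg : Nat.gcd N (sievePrimes.prod ^ 7) ∣ N := Nat.gcd_dvd_left _ _
  have hR0 : N / Nat.gcd N (sievePrimes.prod ^ 7) ≠ 0 :=
    (Nat.div_pos (Nat.le_of_dvd (Nat.pos_of_ne_zero hN) hg)
      (Nat.gcd_pos_of_pos_left _ (Nat.pos_of_ne_zero hN))).ne'
  have hdR : ∏ r ∈ B, r ∣ N / Nat.gcd N (sievePrimes.prod ^ 7) := by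
    refine hcop.dvd_of_dvd_mul_right ?_
    rwa [Nat.div_mul_cancel hg]
  have h64 : 64 ^ B.card ≤ N / Nat.gcd N (sievePrimes.prod ^ 7) := by
    refine le_trans ?_ (Nat.le_of_dvd (Nat.pos_of_ne_zero hR0) hdR)
    refine Finset.pow_card_le_prod _ _ _ fun r hr => ?_
    by_contra! hlt
    exact (hmem r hr).2.2 (mem_sievePrimes_of_lt (hmem r hr).1 hlt)
  rw [Nat.le_div_iff_mul_le (by norm_num), Nat.le_log2 hR0, mul_comm, pow_mul]
  exact h64

theorem exists_sieveSucceeds_of_sieveCheck {q n y : ℕ} (hq : 2 ≤ q) (hn : 4 ≤ n)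
    (h : sieveCheck q n y = true) :
    ∃ C S : Finset ℕ, Disjoint C S ∧
      (∀ r, r ∈ C ∪ S ↔ r.Prime ∧ r ∣ (q ^ n - 1) / (q - 1)) ∧ SieveSucceeds q n C S := by
  classical
  unfold sieveCheck at h
  set N := (q ^ n - 1) / (q - 1) with hNdef
  have hN0 : N ≠ 0 := (Nat.div_pos
    (Nat.sub_le_sub_right (Nat.le_self_pow (by omega) q) 1) (by omega)).ne'
  set D := sievePrimes.filter fun r => N % r == 0 with hD
  have hDmem : ∀ r, r ∈ D ↔ r ∈ sievePrimes ∧ r ∣ N := fun r => by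
    rw [hD, List.mem_filter, beq_iff_eq, Nat.dvd_iff_mod_eq_zero]
  set Cl := D.filter fun r => Nat.ble r y with hCl
  set Sl := D.filter fun r => !Nat.ble r y with hSl
  set B := N.primeFactors \ sievePrimes.toFinset with hB
  set k := Nat.log2 (N / Nat.gcd N (sievePrimes.prod ^ 7)) / 6 with hk
  have hBk : B.card ≤ k := card_primeFactors_sdiff_le hN0
  have hDn : D.Nodup := nodup_sievePrimes.filter _
  have hSn : Sl.Nodup := hDn.filter _
  have hCn : Cl.Nodup := hDn.filter _
  have hSB : Disjoint Sl.toFinset B := by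
    rw [Finset.disjoint_left]
    intro r hr hr'
    rw [List.mem_toFinset, hSl, List.mem_filter, hDmem] at hr
    rw [hB, Finset.mem_sdiff, List.mem_toFinset] at hr'
    exact hr'.2 hr.1.1
  refine ⟨Cl.toFinset, Sl.toFinset ∪ B, ?_, ?_, ?_⟩
  · rw [Finset.disjoint_left]
    intro r hr hr'
    rw [List.mem_toFinset, hCl, List.mem_filter, hDmem] at hr
    rw [Finset.mem_union, List.mem_toFinset, hSl, List.mem_filter, hB, Finset.mem_sdiff,
      List.mem_toFinset] at hr'
    rcases hr' with h' | h'
    · simp [hr.2] at h'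
    · exact h'.2 hr.1.1
  · intro r
    simp only [Finset.mem_union, List.mem_toFinset, hCl, hSl, List.mem_filter, hDmem, hB,
      Finset.mem_sdiff, Nat.mem_primeFactors]
    constructor
    · rintro (⟨h1, -⟩ | ⟨h1, -⟩ | ⟨h1, -⟩)
      · exact ⟨prime_of_mem_sievePrimes r h1.1, h1.2⟩
      · exact ⟨prime_of_mem_sievePrimes r h1.1, h1.2⟩
      · exact ⟨h1.1, h1.2.1⟩
    · rintro ⟨h1, h2⟩
      by_cases hr : r ∈ sievePrimes
      · cases hy : Nat.ble r y <;> simp [hr, h2]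
      · exact Or.inr (Or.inr ⟨⟨h1, h2, hN0⟩, hr⟩)
  · unfold SieveSucceeds
    set t₁ := linearBound q n with ht1
    set t₂ := (n - 2 - t₁) / 2 with ht2
    simp only [Bool.and_eq_true, Nat.blt_eq] at h
    set l := k * (10 ^ 6 / 64 + 1) + t₁ * (10 ^ 6 / q + 1) + t₂ * (10 ^ 6 / q ^ 2 + 1) +
      (Sl.map fun r => 10 ^ 6 / r + 1).sum with hl
    obtain ⟨hlT, hmain⟩ := h
    rw [List.toFinset_card_of_nodup hCn, Finset.card_union_of_disjoint hSB,
      List.toFinset_card_of_nodup hSn, Finset.sum_union hSB]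
    set T : ℝ := 10 ^ 6 with hT
    have hTc : ((10 ^ 6 : ℕ) : ℝ) = T := by rw [hT]; norm_num
    have hT0 : 0 < T := by positivity
    have hq0 : (0 : ℝ) < q := by exact_mod_cast (by omega : 0 < q)
    have e1 : T * (∑ p ∈ Sl.toFinset, 1 / (p : ℝ)) ≤
        ((Sl.map fun r => 10 ^ 6 / r + 1).sum : ℕ) := by
      rw [← List.sum_toFinset _ hSn, Finset.mul_sum, Nat.cast_sum]
      refine Finset.sum_le_sum fun r _ => ?_
      rw [mul_one_div, ← hTc]
      exact div_le_natDiv_add_one _ _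
    have e2 : T * (∑ p ∈ B, 1 / (p : ℝ)) ≤ (k * (10 ^ 6 / 64 + 1) : ℕ) := by
      have h1 : ∑ p ∈ B, 1 / (p : ℝ) ≤ k * (1 / 64) := by
        refine (Finset.sum_le_card_nsmul B _ (1 / 64) fun r hr => ?_).trans ?_
        · rw [hB, Finset.mem_sdiff, Nat.mem_primeFactors, List.mem_toFinset] at hr
          have : 64 ≤ r := by
            by_contra! hlt
            exact hr.2 (mem_sievePrimes_of_lt hr.1.1 hlt)
          exact one_div_le_one_div_of_le (by norm_num) (by exact_mod_cast this)
        · rw [nsmul_eq_mul]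
          have : (B.card : ℝ) ≤ k := by exact_mod_cast hBk
          gcongr
      have h2 := div_le_natDiv_add_one (10 ^ 6) 64
      rw [hTc] at h2
      rw [Nat.cast_mul]
      calc T * (∑ p ∈ B, 1 / (p : ℝ)) ≤ T * (k * (1 / 64)) := by gcongr
        _ = k * (T / 64) := by ring
        _ ≤ _ := by
          refine mul_le_mul_of_nonneg_left ?_ (Nat.cast_nonneg _)
          exact_mod_cast h2
    have e3 : T * (t₁ / q) ≤ (t₁ * (10 ^ 6 / q + 1) : ℕ) := by
      have h2 := div_le_natDiv_add_one (10 ^ 6) q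
      rw [hTc] at h2
      rw [Nat.cast_mul, mul_div_left_comm]
      gcongr
    have e4 : T * (t₂ / (q : ℝ) ^ 2) ≤ (t₂ * (10 ^ 6 / q ^ 2 + 1) : ℕ) := by
      have h2 := div_le_natDiv_add_one (10 ^ 6) (q ^ 2)
      rw [hTc, Nat.cast_pow] at h2
      rw [Nat.cast_mul, mul_div_left_comm]
      gcongr
    have hlsum : T * ((∑ p ∈ Sl.toFinset, 1 / (p : ℝ) + ∑ p ∈ B, 1 / (p : ℝ)) +
        (t₁ / q + t₂ / (q : ℝ) ^ 2)) ≤ l := by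
      rw [hl]
      push_cast at e1 e2 e3 e4 ⊢
      linarith
    have hmainR : ((2 : ℝ) ^ Cl.length * (1 + Sl.length + k + t₁ + t₂) * T) ^ 2 <
        (q : ℝ) ^ (n - 4) * (T - l) ^ 2 := by
      obtain ⟨m, hm⟩ : ∃ m, m = 10 ^ 6 - l := ⟨_, rfl⟩
      have hm' : (m : ℝ) = T - l := by rw [hm, Nat.cast_sub hlT.le, hTc]
      have h1 : (2 ^ Cl.length * (1 + Sl.length + k + t₁ + t₂) * 10 ^ 6) ^ 2 <
          q ^ (n - 4) * m ^ 2 := by rw [hm]; exact hmain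
      have h2 := (Nat.cast_lt (α := ℝ)).2 h1
      rw [← hm', hT]
      push_cast at h2 ⊢
      norm_num at h2 ⊢
      exact h2
    have hlT' : (l : ℝ) < T := by rw [← hTc]; exact_mod_cast hlT
    set c : ℝ := (2 : ℝ) ^ Cl.length * (1 + Sl.length + k + t₁ + t₂) with hc
    have hc0 : 0 ≤ c := by positivity
    have hkey : c * √((q : ℝ) ^ n) * T < (q : ℝ) ^ (n - 2) * (T - l) := by
      refine lt_of_pow_lt_pow_left₀ 2 (mul_nonneg (by positivity) (by linarith)) ?_
      have h1 : (c * √((q : ℝ) ^ n) * T) ^ 2 = (c * T) ^ 2 * (q : ℝ) ^ n := by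
        rw [mul_pow, mul_pow, Real.sq_sqrt (by positivity)]
        ring
      have h2 : ((q : ℝ) ^ (n - 2) * (T - l)) ^ 2 =
          ((q : ℝ) ^ (n - 4) * (T - l) ^ 2) * (q : ℝ) ^ n := by
        rw [mul_pow, ← pow_mul, mul_right_comm, ← pow_add]
        congr 2
        omega
      rw [h1, h2]
      exact mul_lt_mul_of_pos_right hmainR (by positivity)
    refine lt_of_mul_lt_mul_right ?_ hT0.le
    refine lt_of_le_of_lt ?_ (hkey.trans_le ?_)
    · have : (B.card : ℝ) ≤ k := by exact_mod_cast hBk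
      rw [hc]
      push_cast
      gcongr ?_ * _ * _
      gcongr ?_ * ?_
      linarith
    · rw [mul_assoc]
      refine mul_le_mul_of_nonneg_left ?_ (by positivity)
      linarith

/-- The pairs `(q, n)` with `q < 1024` not covered by `sieveCheck`. -/
def smallPairs : List (ℕ × ℕ) :=
  [(2, 8), (3, 8), (4, 8), (5, 8), (9, 8), (2, 9), (3, 9), (4, 9), (2, 10), (3, 10), (2, 12),
    (3, 12), (4, 12), (2, 14), (2, 15), (3, 15), (2, 16), (2, 18), (3, 18), (4, 18)]

/-- A condition satisfied by all prime powers below `1024`. -/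
def primePowerCheck (q : ℕ) : Bool :=
  [2, 3, 5, 7, 11, 13, 17, 19, 23, 29, 31].all fun r => !(q % r == 0) || r ^ 10 % q == 0

theorem primePowerCheck_of_isPrimePow {q : ℕ} (hq : IsPrimePow q) (h : q < 1024) :
    primePowerCheck q = true := by
  unfold primePowerCheck
  rw [List.all_eq_true]
  intro r hr
  have hrp : r.Prime := by
    simp only [List.mem_cons, List.not_mem_nil, or_false] at hr
    rcases hr with rfl | rfl | rfl | rfl | rfl | rfl | rfl | rfl | rfl | rfl | rfl <;> norm_num
  obtain ⟨p, k, hp, hk, rfl⟩ := hq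
  have hp := hp.nat_prime
  rw [Bool.or_eq_true, Bool.not_eq_true', beq_eq_false_iff_ne, beq_iff_eq]
  by_cases hrd : r ∣ p ^ k
  · right
    obtain rfl := (Nat.prime_dvd_prime_iff_eq hrp hp).1 (hrp.dvd_of_dvd_pow hrd)
    have hk10 : k < 10 := by
      have : 2 ^ k < 2 ^ 10 := (Nat.pow_le_pow_left hrp.two_le k).trans_lt (by simpa using h)
      exact (Nat.pow_lt_pow_iff_right (by norm_num)).1 this
    exact Nat.dvd_iff_mod_eq_zero.1 (pow_dvd_pow _ hk10.le)
  · left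
    exact fun h' => hrd (Nat.dvd_of_mod_eq_zero h')

theorem sieveCheck_of_lt : ∀ n ∈ List.range' 8 11, ∀ q ∈ List.range' 2 1022,
    (!primePowerCheck q || Nat.gcd (q ^ 3 - q) n == 1 || smallPairs.contains (q, n) ||
      sieveCheck q n 2 || sieveCheck q n 0 || sieveCheck q n 3 || sieveCheck q n 5 ||
      sieveCheck q n 7 || sieveCheck q n 13) = true := by
  decide +kernel

theorem exists_primitive_of_lt {q n : ℕ} (hq : IsPrimePow q) (hn8 : 8 ≤ n) (hn18 : n ≤ 18)
    (h : Nat.gcd (q ^ 3 - q) n ≠ 1) (hlt : q < 1024) (hs : (q, n) ∉ smallPairs)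
    {E : Type*} [Field E] [Fintype E] (hE : Fintype.card E = q ^ n) :
    ∃ α : E, IsPrimitiveElem α ∧ IsKNormal q n 2 α := by
  have h2 := hq.two_le
  have key := sieveCheck_of_lt n (by rw [List.mem_range'_1]; omega) q
    (by rw [List.mem_range'_1]; omega)
  simp only [primePowerCheck_of_isPrimePow hq hlt, Bool.or_eq_true, beq_iff_eq, h,
    List.contains_iff_mem, hs, Bool.not_true, Bool.false_eq_true, false_or, or_assoc] at key
  have key' : ∃ y, sieveCheck q n y = true := by
    rcases key with h | h | h | h | h | h <;> exact ⟨_, h⟩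
  obtain ⟨y, hy⟩ := key'
  obtain ⟨C, S, hCS, hp, hS⟩ := exists_sieveSucceeds_of_sieveCheck h2 (by omega) hy
  exact exists_primitive_of_sieveSucceeds hq (by omega) h C S hCS hp hS hE

end SieveCheck

section LargeCard

theorem pow_card_primeFactors_mul_primorial_le {N : ℕ} (hN : N ≠ 0) :
    64 ^ N.primeFactors.card * primorial 63 ≤ 64 ^ 18 * N := by
  set L := (Finset.range (63 + 1)).filter Nat.Prime with hL
  have hLc : L.card = 18 := by decide +kernel
  set A := N.primeFactors.filter (· < 64) with hA
  set B := N.primeFactors.filter fun p => ¬ p < 64 with hB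
  have hAL : A ⊆ L := fun p hp => by
    rw [hA, Finset.mem_filter] at hp
    rw [hL, Finset.mem_filter, Finset.mem_range]
    exact ⟨hp.2, Nat.prime_of_mem_primeFactors hp.1⟩
  have h1 : 64 ^ B.card ≤ ∏ p ∈ B, p := Finset.pow_card_le_prod _ _ _ fun p hp =>
    not_lt.1 (Finset.mem_filter.1 hp).2
  have h2 : ∏ p ∈ L \ A, p ≤ 64 ^ (L \ A).card := Finset.prod_le_pow_card _ _ _ fun p hp => by
    have := Finset.mem_range.1 (Finset.mem_filter.1 (Finset.mem_sdiff.1 hp).1).1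
    omega
  have h3 : primorial 63 = (∏ p ∈ L \ A, p) * ∏ p ∈ A, p := (Finset.prod_sdiff hAL).symm
  have h4 : (L \ A).card + A.card = 18 := by rw [Finset.card_sdiff_add_card_eq_card hAL, hLc]
  have h5 : (∏ p ∈ A, p) * ∏ p ∈ B, p ≤ N := by
    rw [Finset.prod_filter_mul_prod_filter_not]
    exact Nat.le_of_dvd (Nat.pos_of_ne_zero hN) (Nat.prod_primeFactors_dvd N)
  have h6 : A.card + B.card = N.primeFactors.card := Finset.card_filter_add_card_filter_not _
  calc 64 ^ N.primeFactors.card * primorial 63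
      = 64 ^ A.card * 64 ^ B.card * ((∏ p ∈ L \ A, p) * ∏ p ∈ A, p) := by
        rw [← h6, pow_add, h3]
    _ ≤ 64 ^ A.card * (∏ p ∈ B, p) * (64 ^ (L \ A).card * ∏ p ∈ A, p) := by gcongr
    _ = 64 ^ ((L \ A).card + A.card) * ((∏ p ∈ A, p) * ∏ p ∈ B, p) := by ring
    _ ≤ 64 ^ 18 * N := by rw [h4]; gcongr

theorem le_mul_of_mul_le_mul {a b c d N : ℕ} (hc : 0 < c) (h : a * c ≤ b * N) (hb : b ≤ d * c) :
    a ≤ d * N := by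
  refine Nat.le_of_mul_le_mul_right (h.trans ?_) hc
  rw [mul_right_comm]
  exact Nat.mul_le_mul_right _ hb

theorem linearBound_le {q n : ℕ} (hq : 2 ≤ q) (hn : 4 ≤ n) : linearBound q n ≤ n - 2 := by
  unfold linearBound
  have hle : Nat.gcd n (q - 1) ≤ n := Nat.gcd_le_left _ (by omega)
  split_ifs with h
  · omega
  · obtain ⟨c, hc⟩ := Nat.gcd_dvd_left n (q - 1)
    by_contra! hlt
    have hc1 : c = 1 := by
      rcases c with _ | _ | c
      · omega
      · rfl
      · have : Nat.gcd n (q - 1) * 2 ≤ Nat.gcd n (q - 1) * (c + 1 + 1) :=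
          Nat.mul_le_mul_left _ (by omega)
        omega
    rw [hc1, mul_one] at hc
    refine h ⟨?_, by omega⟩
    have h1 : n ∣ q - 1 := hc ▸ Nat.gcd_dvd_right n (q - 1)
    have h2 : (q - 1).Coprime q := by
      have := Nat.coprime_self_add_right (m := q - 1) (n := 1)
      rw [show q - 1 + 1 = q by omega] at this
      exact this.2 (Nat.coprime_one_right _)
    exact Nat.Coprime.coprime_dvd_left h1 h2

theorem exists_primitive_of_ge {q n : ℕ} (hq : IsPrimePow q) (hn8 : 8 ≤ n) (hn18 : n ≤ 18)
    (h : Nat.gcd (q ^ 3 - q) n ≠ 1) (hge : 1024 ≤ q)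
    {E : Type*} [Field E] [Fintype E] (hE : Fintype.card E = q ^ n) :
    ∃ α : E, IsPrimitiveElem α ∧ IsKNormal q n 2 α := by
  set N := (q ^ n - 1) / (q - 1) with hN
  have hN0 : N ≠ 0 := (Nat.div_pos
    (Nat.sub_le_sub_right (Nat.le_self_pow (by omega) q) 1) (by omega)).ne'
  refine exists_primitive_of_sieveSucceeds hq (by omega) h N.primeFactors ∅ (by simp)
    (fun r => by
      rw [Finset.union_empty, Nat.mem_primeFactors]
      exact ⟨fun hr => ⟨hr.1, hr.2.1⟩, fun hr => ⟨hr.1, hr.2, hN0⟩⟩) ?_ hE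
  unfold SieveSucceeds
  have hT : linearBound q n + (n - 2 - linearBound q n) / 2 ≤ n - 2 := by
    have := linearBound_le (q := q) (n := n) (by omega) (by omega)
    omega
  set t₁ := linearBound q n
  set t₂ := (n - 2 - t₁) / 2
  have hqR : (1024 : ℝ) ≤ q := by exact_mod_cast hge
  have hq0 : (0 : ℝ) < q := by linarith
  have hTR : (t₁ + t₂ : ℝ) ≤ 16 := by exact_mod_cast hT.trans (by omega)
  have hτ : t₁ / q + t₂ / (q : ℝ) ^ 2 ≤ 1 / 64 := by
    have h1 : t₂ / (q : ℝ) ^ 2 ≤ t₂ / q :=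
      div_le_div_of_nonneg_left (Nat.cast_nonneg _) hq0 (by nlinarith)
    have h2 : (t₁ + t₂ : ℝ) / q ≤ 16 / 1024 := by gcongr
    rw [add_div] at h2
    linarith
  have hNq : (N : ℝ) ≤ 2 * (q : ℝ) ^ (n - 1) := by
    have h1 : N * (q - 1) ≤ q ^ n - 1 := Nat.div_mul_le_self _ _
    have h2 : N * q ≤ 2 * q ^ (n - 1) * q := by
      have h3 : q ^ (n - 1) * q = q ^ n := by rw [← pow_succ]; congr 1; omega
      have h4 : N * q ≤ 2 * (N * (q - 1)) := by
        rw [mul_left_comm]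
        exact Nat.mul_le_mul_left _ (by omega)
      rw [mul_assoc, h3]
      omega
    exact_mod_cast Nat.le_of_mul_le_mul_right h2 (by omega)
  clear_value N
  set w : ℝ := 2 ^ N.primeFactors.card with hw
  have hw6 : w ^ 6 ≤ 2770000000 * N := by
    have h1 := pow_card_primeFactors_mul_primorial_le hN0
    have h2 : primorial 63 = 117288381359406970983270 := by decide +kernel
    have h3 : w ^ 6 = ((64 ^ N.primeFactors.card : ℕ) : ℝ) := by
      rw [hw, ← pow_mul, mul_comm, pow_mul]
      norm_num
    rw [h3]
    have h4 : 64 ^ N.primeFactors.card ≤ 2770000000 * N := by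
      refine le_mul_of_mul_le_mul (primorial_pos 63) h1 ?_
      rw [h2]
      norm_num
    exact_mod_cast h4
  have hnum : (2770000000 * 2 * ((n - 1 : ℕ) : ℝ) ^ 6) <
      (q : ℝ) ^ (2 * n - 11) * (63 / 64) ^ 6 := by
    have h1 : (1024 : ℝ) ^ (2 * n - 11) ≤ (q : ℝ) ^ (2 * n - 11) := by gcongr
    refine lt_of_lt_of_le ?_ (mul_le_mul_of_nonneg_right h1 (by positivity))
    clear * - hn8 hn18
    interval_cases n <;> norm_num
  have hmain : w * ((n - 1 : ℕ) : ℝ) * √((q : ℝ) ^ n) < (q : ℝ) ^ (n - 2) * (63 / 64) := by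
    refine lt_of_pow_lt_pow_left₀ 6 (by positivity) ?_
    have h1 : √((q : ℝ) ^ n) ^ 6 = (q : ℝ) ^ (3 * n) := by
      rw [show 6 = 2 * 3 by norm_num, pow_mul, Real.sq_sqrt (by positivity), ← pow_mul, mul_comm]
    calc (w * ((n - 1 : ℕ) : ℝ) * √((q : ℝ) ^ n)) ^ 6
        = w ^ 6 * ((n - 1 : ℕ) : ℝ) ^ 6 * (q : ℝ) ^ (3 * n) := by rw [mul_pow, mul_pow, h1]
      _ ≤ 2770000000 * (2 * (q : ℝ) ^ (n - 1)) * ((n - 1 : ℕ) : ℝ) ^ 6 * (q : ℝ) ^ (3 * n) := by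
        gcongr
        linarith
      _ = 2770000000 * 2 * ((n - 1 : ℕ) : ℝ) ^ 6 * ((q : ℝ) ^ (n - 1) * (q : ℝ) ^ (3 * n)) := by
        ring
      _ < (q : ℝ) ^ (2 * n - 11) * (63 / 64) ^ 6 * ((q : ℝ) ^ (n - 1) * (q : ℝ) ^ (3 * n)) :=
        mul_lt_mul_of_pos_right hnum (by positivity)
      _ = (q : ℝ) ^ ((2 * n - 11) + (n - 1) + 3 * n) * (63 / 64) ^ 6 := by
        rw [pow_add, pow_add]
        ring
      _ = ((q : ℝ) ^ (n - 2) * (63 / 64)) ^ 6 := by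
        rw [mul_pow, ← pow_mul]
        congr 2
        omega
  have hc : (1 + ((∅ : Finset ℕ).card : ℝ) + (t₁ + t₂ : ℕ)) ≤ ((n - 1 : ℕ) : ℝ) := by
    rw [Finset.card_empty, Nat.cast_zero, add_zero]
    have : 1 + (t₁ + t₂) ≤ n - 1 := by omega
    exact_mod_cast this
  rw [Finset.sum_empty, sub_zero]
  refine lt_of_le_of_lt ?_ (hmain.trans_le ?_)
  · gcongr
  · gcongr
    linarith

end LargeCard

section Necessity

variable {K : Type*} [Field K] [Fintype K]

theorem pow_card_sq_eq_self_of_natDegree_le_two {L : Type*} [Field L] [Algebra K L] {u : L}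
    {G : K[X]} (hG : G ≠ 0) (hd : G.natDegree ≤ 2) (hu : aeval u G = 0) :
    u ^ Fintype.card K ^ 2 = u := by
  have hu_int : IsIntegral K u := isAlgebraic_iff_isIntegral.1 ⟨G, hG, hu⟩
  have hle : (minpoly K u).natDegree ≤ 2 :=
    (natDegree_le_of_dvd (minpoly.dvd K u hu) hG).trans hd
  have hpos := minpoly.natDegree_pos hu_int
  have hdvd : (minpoly K u).natDegree ∣ 2 := by
    interval_cases (minpoly K u).natDegree <;> norm_num
  obtain ⟨c, hc⟩ := (minpoly.irreducible hu_int).natDegree_dvd_iff_dvd_X_pow_card_pow_sub_X.1 hdvd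
  have := congrArg (aeval u) hc
  simp only [map_mul, minpoly.aeval, zero_mul, map_sub, map_pow, aeval_X] at this
  rw [← Nat.card_eq_fintype_card]
  exact sub_eq_zero.1 this

theorem natDegree_ne_two_of_dvd_X_pow_sub_one {n : ℕ} (hn : n ≠ 0)
    (h : Nat.gcd (Fintype.card K ^ 3 - Fintype.card K) n = 1) {G : K[X]}
    (hG : G ∣ X ^ n - 1) : G.natDegree ≠ 2 := by
  classical
  intro hd
  have hq : 1 < Fintype.card K := Fintype.one_lt_card
  have hfac : Fintype.card K ^ 3 - Fintype.card K
      = Fintype.card K * (Fintype.card K ^ 2 - 1) := by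
    rw [Nat.mul_sub, mul_one, pow_succ' _ 2]
  rw [hfac] at h
  have hcop := Nat.Coprime.coprime_mul_right h
  have hcop2 : Nat.Coprime (Fintype.card K ^ 2 - 1) n := Nat.Coprime.coprime_mul_left h
  have hnK : (n : K) ≠ 0 := natCast_ne_zero_of_coprime_card hcop.symm
  have hsep : (X ^ n - 1 : K[X]).Separable := by
    simpa using separable_X_pow_sub_C (1 : K) hnK one_ne_zero
  have hG0 : G ≠ 0 := fun h0 => by simp [h0] at hd
  set L := AlgebraicClosure K
  have hcard : Fintype.card (G.rootSet L) = 2 := by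
    rw [card_rootSet_eq_natDegree (hsep.of_dvd hG) (IsAlgClosed.splits _), hd]
  have hsub : Subsingleton (G.rootSet L) := by
    have hone : ∀ u : G.rootSet L, (u : L) = 1 := by
      rintro ⟨u, hu⟩
      have hu0 : aeval u G = 0 := (mem_rootSet.1 hu).2
      have h1 : u ^ n = 1 := by
        obtain ⟨c, hc⟩ := hG
        have := congrArg (aeval u) hc
        rw [map_mul, hu0, zero_mul] at this
        simpa [sub_eq_zero] using this
      have hune : u ≠ 0 := by
        rintro rfl
        rw [zero_pow hn] at h1
        exact zero_ne_one h1
      have h2 : u ^ (Fintype.card K ^ 2 - 1) = 1 := by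
        have h3 := pow_card_sq_eq_self_of_natDegree_le_two hG0 hd.le hu0
        rw [← Nat.sub_add_cancel (Nat.one_le_pow 2 _ (by omega)), pow_succ] at h3
        exact mul_eq_right₀ hune |>.1 h3
      have := orderOf_dvd_iff_pow_eq_one.2 h1
      have := Nat.dvd_gcd (orderOf_dvd_iff_pow_eq_one.2 h2) this
      rw [hcop2.gcd_eq_one, Nat.dvd_one, orderOf_eq_one_iff] at this
      exact this
    exact ⟨fun a b => Subtype.ext ((hone a).trans (hone b).symm)⟩
  have := Fintype.card_le_one_iff_subsingleton.2 hsub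
  omega

theorem gcd_ne_one_of_isKNormal {q n : ℕ} (hq : IsPrimePow q) (hn : n ≠ 0)
    {E : Type*} [Field E] [Fintype E] (hE : Fintype.card E = q ^ n) {α : E}
    (hα : IsKNormal q n 2 α) : Nat.gcd (q ^ 3 - q) n ≠ 1 := by
  classical
  obtain ⟨K, _, _, ⟨_⟩, hK⟩ := exists_subfield_card_eq hq hn E hE
  subst hK
  intro h
  obtain ⟨G, hG, hass⟩ := exists_map_eq_gcd hn hE α
  have hdvd : G.map (algebraMap K E) ∣ (X ^ n - 1 : K[X]).map (algebraMap K E) := by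
    refine hass.dvd.trans ?_
    simpa using @EuclideanDomain.gcd_dvd_left _ _ (Classical.decEq _) _ _
  refine natDegree_ne_two_of_dvd_X_pow_sub_one hn h ((map_dvd_map' _).1 hdvd) ?_
  rw [← natDegree_map (algebraMap K E),
    natDegree_eq_of_degree_eq (degree_eq_degree_of_associated hass)]
  exact hα

end Necessity

section PackedArithmetic

/-- Coefficientwise sum of coefficient lists. -/
def addDigits : List ℕ → List ℕ → List ℕ
  | [], b => b
  | a, [] => a
  | c :: a, d :: b => (c + d) :: addDigits a b

/-- Product of coefficient lists. -/
def mulDigits : List ℕ → List ℕ → List ℕ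
  | [], _ => []
  | c :: a, b => addDigits (b.map (c * ·)) (0 :: mulDigits a b)

section ofDigits

variable {R : Type*} [CommSemiring R] (a : R)

theorem ofDigits_cons_eq (c : ℕ) (l : List ℕ) :
    Nat.ofDigits a (c :: l) = c + a * Nat.ofDigits a l := rfl

theorem ofDigits_addDigits (l m : List ℕ) :
    Nat.ofDigits a (addDigits l m) = Nat.ofDigits a l + Nat.ofDigits a m := by
  induction l, m using addDigits.induct with
  | case1 b => simp [addDigits, Nat.ofDigits]
  | case2 l h => cases l <;> simp [addDigits, Nat.ofDigits]
  | case3 c l d b ih =>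
    simp only [addDigits, ofDigits_cons_eq, ih]
    push_cast
    ring

theorem ofDigits_map_mul (k : ℕ) (l : List ℕ) :
    Nat.ofDigits a (l.map (k * ·)) = k * Nat.ofDigits a l := by
  induction l with
  | nil => simp [Nat.ofDigits]
  | cons c l ih =>
    simp only [List.map_cons, ofDigits_cons_eq, ih]
    push_cast
    ring

theorem ofDigits_mulDigits (l m : List ℕ) :
    Nat.ofDigits a (mulDigits l m) = Nat.ofDigits a l * Nat.ofDigits a m := by
  induction l with
  | nil => simp [mulDigits, Nat.ofDigits]
  | cons c l ih =>
    simp only [mulDigits, ofDigits_addDigits, ofDigits_map_mul, ofDigits_cons_eq, ih]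
    push_cast
    ring

theorem ofDigits_take_add_drop (d : ℕ) (l : List ℕ) :
    Nat.ofDigits a (l.take d) + a ^ d * Nat.ofDigits a (l.drop d) = Nat.ofDigits a l := by
  induction d generalizing l with
  | zero => simp [Nat.ofDigits]
  | succ d ih =>
    cases l with
    | nil => simp [Nat.ofDigits]
    | cons c l =>
      simp only [List.take_succ_cons, List.drop_succ_cons, ofDigits_cons_eq, ← ih l]
      ring

end ofDigits

theorem length_addDigits_le {l m : List ℕ} {L : ℕ} (hl : l.length ≤ L) (hm : m.length ≤ L) :
    (addDigits l m).length ≤ L := by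
  induction l, m using addDigits.induct generalizing L with
  | case1 b => simpa [addDigits] using hm
  | case2 l h =>
    cases l
    · simp [addDigits]
    · simpa [addDigits] using hl
  | case3 c l d b ih =>
    simp only [addDigits, List.length_cons] at *
    have := ih (L := L - 1) (by omega) (by omega)
    omega

theorem le_of_mem_addDigits {l m : List ℕ} {K M : ℕ} (hl : ∀ c ∈ l, c ≤ K) (hm : ∀ c ∈ m, c ≤ M) :
    ∀ c ∈ addDigits l m, c ≤ K + M := by
  induction l, m using addDigits.induct with
  | case1 b => exact fun c hc => (hm c (by simpa [addDigits] using hc)).trans (Nat.le_add_left _ _)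
  | case2 l h =>
    cases l
    · simp [addDigits]
    · exact fun c hc => (hl c hc).trans (Nat.le_add_right _ _)
  | case3 c l d b ih =>
    simp only [addDigits, List.mem_cons, forall_eq_or_imp] at *
    exact ⟨Nat.add_le_add hl.1 hm.1, ih hl.2 hm.2⟩

theorem length_mulDigits_le {l m : List ℕ} {L M : ℕ} (hl : l.length ≤ L + 1)
    (hm : m.length ≤ M + 1) : (mulDigits l m).length ≤ L + M + 1 := by
  induction l generalizing L with
  | nil => simp [mulDigits]
  | cons c l ih =>
    rw [mulDigits]
    refine length_addDigits_le (by rw [List.length_map]; omega) ?_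
    rw [List.length_cons] at hl ⊢
    cases l with
    | nil => simp [mulDigits]
    | cons c' l =>
      rw [List.length_cons] at hl ih
      have := ih (L := L - 1) (by omega)
      omega

theorem le_of_mem_mulDigits {l m : List ℕ} {K M : ℕ} (hl : ∀ c ∈ l, c ≤ K) (hm : ∀ c ∈ m, c ≤ M) :
    ∀ c ∈ mulDigits l m, c ≤ l.length * (K * M) := by
  induction l with
  | nil => simp [mulDigits]
  | cons c l ih =>
    rw [mulDigits, List.length_cons, Nat.succ_mul, add_comm]
    refine le_of_mem_addDigits ?_ ?_
    · intro x hx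
      obtain ⟨y, hy, rfl⟩ := List.mem_map.1 hx
      exact Nat.mul_le_mul (hl c List.mem_cons_self) (hm y hy)
    · intro x hx
      rcases List.mem_cons.1 hx with rfl | hx
      · exact Nat.zero_le _
      · exact ih (fun y hy => hl y (List.mem_cons_of_mem _ hy)) x hx

theorem ofDigits_digits_ofDigits {R : Type*} [CommSemiring R] (a : R) {B : ℕ} (hB : 1 < B)
    {l : List ℕ} (hl : ∀ c ∈ l, c < B) :
    Nat.ofDigits a (Nat.digits B (Nat.ofDigits B l)) = Nat.ofDigits a l := by
  induction l with
  | nil => simp [Nat.ofDigits]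
  | cons c l ih =>
    rw [List.forall_mem_cons] at hl
    have ih := ih hl.2
    rw [ofDigits_cons_eq, ofDigits_cons_eq, Nat.cast_id]
    by_cases h : c = 0 ∧ Nat.ofDigits B l = 0
    · rw [h.2, Nat.digits_zero] at ih
      rw [← ih]
      simp [h.1, h.2, Nat.ofDigits]
    · rw [Nat.digits_add B hB c _ hl.1 (by tauto), ofDigits_cons_eq, ih]

/-- The number `m` packs, in base `B`, at most `L` coefficients bounded by `K` of a polynomial
whose value at `a` is `e`. -/
def Packs {R : Type*} [CommSemiring R] (B : ℕ) (a : R) (K L m : ℕ) (e : R) : Prop :=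
  ∃ l : List ℕ, l.length ≤ L ∧ (∀ c ∈ l, c ≤ K) ∧ Nat.ofDigits B l = m ∧ Nat.ofDigits a l = e

/-- Reads `d` digits of `m` in base `b` and writes them, reduced modulo `p`, in base `B`. -/
def rebase (B b p : ℕ) : ℕ → ℕ → ℕ
  | 0, _ => 0
  | d + 1, m => m % b % p + B * rebase B b p d (m / b)

/-- Rewrites `s` times the powers of degree at least `d` using `x ^ d = T`. -/
def reducePacked (B d T : ℕ) : ℕ → ℕ → ℕ
  | 0, m => m
  | s + 1, m => reducePacked B d T s (m % B ^ d + T * (m / B ^ d))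

namespace Packs

variable {R : Type*} [CommSemiring R] {B : ℕ} {a : R} {K L m K' L' m' : ℕ} {e e' : R}

theorem mono (h : Packs B a K L m e) (hK : K ≤ K') (hL : L ≤ L') : Packs B a K' L' m e := by
  obtain ⟨l, h1, h2, h3, h4⟩ := h
  exact ⟨l, h1.trans hL, fun c hc => (h2 c hc).trans hK, h3, h4⟩

theorem zero : Packs B a K L 0 0 := ⟨[], by simp [Nat.ofDigits]⟩

theorem natCast (h : m ≤ K) : Packs B a K (L + 1) m m := ⟨[m], by simpa [Nat.ofDigits] using h⟩

theorem self : Packs B a 1 (L + 2) B a := ⟨[0, 1], by simp [Nat.ofDigits]⟩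

theorem add (h : Packs B a K L m e) (h' : Packs B a K' L m' e') :
    Packs B a (K + K') L (m + m') (e + e') := by
  obtain ⟨l, h1, h2, rfl, rfl⟩ := h
  obtain ⟨l', h1', h2', rfl, rfl⟩ := h'
  exact ⟨addDigits l l', length_addDigits_le h1 h1', le_of_mem_addDigits h2 h2',
    ofDigits_addDigits _ _ _, ofDigits_addDigits _ _ _⟩

theorem mul (h : Packs B a K (L + 1) m e) (h' : Packs B a K' (L' + 1) m' e') :
    Packs B a ((L + 1) * (K * K')) (L + L' + 1) (m * m') (e * e') := by
  obtain ⟨l, h1, h2, rfl, rfl⟩ := h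
  obtain ⟨l', h1', h2', rfl, rfl⟩ := h'
  exact ⟨mulDigits l l', length_mulDigits_le h1 h1',
    fun c hc => (le_of_mem_mulDigits h2 h2' c hc).trans (Nat.mul_le_mul_right _ h1),
    ofDigits_mulDigits _ _ _, ofDigits_mulDigits _ _ _⟩

theorem sum {ι : Type*} {s : Finset ι} {f : ι → ℕ} {g : ι → R}
    (h : ∀ i ∈ s, Packs B a K L (f i) (g i)) :
    Packs B a (s.card * K) L (∑ i ∈ s, f i) (∑ i ∈ s, g i) := by
  classical
  induction s using Finset.induction_on with
  | empty => simpa using zero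
  | insert i s hi ih =>
    rw [Finset.sum_insert hi, Finset.sum_insert hi, Finset.card_insert_of_notMem hi, Nat.succ_mul,
      add_comm (_ * K)]
    exact (h i (Finset.mem_insert_self _ _)).add
      (ih fun j hj => h j (Finset.mem_insert_of_mem hj))

theorem eq_ofDigits (h : Packs B a K L m e) (hB : 1 < B) (hK : K < B) :
    e = Nat.ofDigits a (Nat.digits B m) := by
  obtain ⟨l, -, h2, rfl, rfl⟩ := h
  exact (ofDigits_digits_ofDigits a hB fun c hc => (h2 c hc).trans_lt hK).symm

theorem unique (h : Packs B a K L m e) (h' : Packs B a K' L' m e') (hB : 1 < B) (hK : K < B)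
    (hK' : K' < B) : e = e' :=
  (h.eq_ofDigits hB hK).trans (h'.eq_ofDigits hB hK').symm

theorem exists_rebase {b p : ℕ} (hp : 0 < p) (d m : ℕ) :
    ∃ e, Packs B a (p - 1) d (rebase B b p d m) e := by
  induction d generalizing m with
  | zero => exact ⟨0, zero⟩
  | succ d ih =>
    obtain ⟨_, l, h1, h2, h3, rfl⟩ := ih (m / b)
    refine ⟨_, m % b % p :: l, by simpa using h1, ?_, ?_, rfl⟩
    · rw [List.forall_mem_cons]
      exact ⟨Nat.le_sub_one_of_lt (Nat.mod_lt _ hp), h2⟩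
    · rw [ofDigits_cons_eq, h3, rebase, Nat.cast_id]

theorem normalize {p d : ℕ} (h : Packs B a K L m e) (hp : 0 < p) (hp0 : (p : R) = 0) (hK : K < B)
    (hL : L ≤ d) : Packs B a (p - 1) d (rebase B B p d m) e := by
  obtain ⟨l, h1, h2, rfl, rfl⟩ := h
  replace h1 := h1.trans hL
  clear hL
  induction d generalizing l with
  | zero =>
    obtain rfl : l = [] := List.eq_nil_of_length_eq_zero (by omega)
    exact zero
  | succ d ih =>
    cases l with
    | nil =>
      obtain ⟨l, h3, h4, h5, h6⟩ := ih [] (by simp) (by simp)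
      refine ⟨0 :: l, by simpa using h3, by simpa using h4, ?_, ?_⟩
      · rw [ofDigits_cons_eq, h5]
        simp [rebase, Nat.ofDigits]
      · rw [ofDigits_cons_eq, h6]
        simp [Nat.ofDigits]
    | cons c l =>
      rw [List.forall_mem_cons] at h2
      obtain ⟨l', h3, h4, h5, h6⟩ := ih l h2.2 (by simpa using h1)
      have hc : c < B := h2.1.trans_lt hK
      refine ⟨c % p :: l', by simpa using h3, ?_, ?_, ?_⟩
      · rw [List.forall_mem_cons]
        exact ⟨Nat.le_sub_one_of_lt (Nat.mod_lt _ hp), h4⟩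
      · rw [ofDigits_cons_eq, h5, ofDigits_cons_eq, rebase, Nat.cast_id, Nat.cast_id,
          Nat.add_mul_mod_self_left, Nat.mod_eq_of_lt hc,
          Nat.add_mul_div_left _ _ (by omega), Nat.div_eq_of_lt hc, zero_add]
      · rw [ofDigits_cons_eq, h6, ofDigits_cons_eq]
        congr 1
        conv_rhs => rw [← Nat.mod_add_div c p]
        simp [hp0]

theorem reduce {T Q t d k : ℕ} (hT : Packs B a Q (t + 1) T (a ^ d)) (ht : t < d) (hB : 0 < B)
    (s : ℕ) (h : Packs B a K (d + k) m e) (hK : K * (1 + (t + 1) * Q) ^ s < B) :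
    Packs B a (K * (1 + (t + 1) * Q) ^ s) (d + (k - s * (d - t))) (reducePacked B d T s m) e := by
  induction s generalizing K k m with
  | zero => simpa [reducePacked] using h
  | succ s ih =>
    have hKB : K < B := lt_of_le_of_lt (Nat.le_mul_of_pos_right _ (by positivity)) hK
    obtain ⟨l, h1, h2, rfl, rfl⟩ := h
    have hlo : Packs B a K d (Nat.ofDigits B l % B ^ d) (Nat.ofDigits a (l.take d)) :=
      ⟨l.take d, by simp, fun c hc => h2 c (List.mem_of_mem_take hc),
        (Nat.ofDigits_mod_pow_eq_ofDigits_take d hB l fun c hc => (h2 c hc).trans_lt hKB).symm, rfl⟩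
    have hhi : Packs B a K (k - 1 + 1) (Nat.ofDigits B l / B ^ d) (Nat.ofDigits a (l.drop d)) :=
      ⟨l.drop d, by rw [List.length_drop]; omega, fun c hc => h2 c (List.mem_of_mem_drop hc),
        (Nat.ofDigits_div_pow_eq_ofDigits_drop d hB l fun c hc => (h2 c hc).trans_lt hKB).symm, rfl⟩
    have hstep := (hlo.mono le_rfl (L' := d + (k - (d - t))) (by omega)).add
      ((hT.mul hhi).mono le_rfl (by omega))
    rw [ofDigits_take_add_drop] at hstep
    have hmul : K + (t + 1) * (Q * K) = K * (1 + (t + 1) * Q) := by ring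
    rw [hmul] at hstep
    have := ih hstep (by rwa [mul_assoc, ← pow_succ'])
    rw [mul_assoc, ← pow_succ', Nat.sub_sub, Nat.add_comm (d - t), ← Nat.succ_mul] at this
    exact this

end Packs

end PackedArithmetic

section CyclicProducts

theorem cyclic_mul_eq {S : Type*} [CommRing S] {n : ℕ} {y : S} (hy : y ^ n = 1)
    (v b c : ℕ → S)
    (h : ∀ j < n, ∑ i ∈ Finset.range n, v i * b ((n - 1 - j + i) % n) = c j) :
    (∑ i ∈ Finset.range n, v i * y ^ i) * ∑ k ∈ Finset.range n, b k * y ^ (n - 1 - k) =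
      ∑ j ∈ Finset.range n, c j * y ^ j := by
  have hmod : ∀ m, y ^ (m % n) = y ^ m := fun m => by
    conv_rhs => rw [← Nat.mod_add_div m n, pow_add, pow_mul, hy, one_pow, mul_one]
  have hj : ∀ j ∈ Finset.range n,
      c j * y ^ j = ∑ i ∈ Finset.range n, v i * b ((n - 1 - j + i) % n) * y ^ j := fun j hj => by
    rw [← h j (Finset.mem_range.1 hj), Finset.sum_mul]
  rw [Finset.sum_congr rfl hj, Finset.sum_comm, Finset.sum_mul]
  refine Finset.sum_congr rfl fun i hi => ?_
  rw [Finset.mul_sum]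
  have hinv : ∀ j < n, (n - 1 - (n - 1 - j + i) % n + i) % n = j := fun j hj => by
    have hi := Finset.mem_range.1 hi
    rcases lt_or_ge (n - 1 - j + i) n with h1 | h1
    · rw [Nat.mod_eq_of_lt h1, show n - 1 - (n - 1 - j + i) + i = j by omega, Nat.mod_eq_of_lt hj]
    · rw [Nat.mod_eq_sub_mod h1, Nat.mod_eq_of_lt (show n - 1 - j + i - n < n by omega),
        show n - 1 - (n - 1 - j + i - n) + i = j + n by omega, Nat.add_mod_right,
        Nat.mod_eq_of_lt hj]
  have hlt : ∀ j < n, (n - 1 - j + i) % n < n := fun j hj => Nat.mod_lt _ (by omega)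
  refine Finset.sum_bij' (fun k _ => (n - 1 - k + i) % n) (fun j _ => (n - 1 - j + i) % n)
    (fun k hk => Finset.mem_range.2 (hlt k (Finset.mem_range.1 hk)))
    (fun k hk => Finset.mem_range.2 (hlt k (Finset.mem_range.1 hk)))
    (fun k hk => hinv k (Finset.mem_range.1 hk)) (fun k hk => hinv k (Finset.mem_range.1 hk))
    fun k hk => ?_
  simp only [hinv k (Finset.mem_range.1 hk), hmod]
  ring

variable {E : Type*} [Field E]

theorem X_pow_sub_one_dvd_mul_gPoly_sub {q n : ℕ} {α : E} (v c : ℕ → E)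
    (h : ∀ j < n, ∑ i ∈ Finset.range n, v i * α ^ q ^ ((n - 1 - j + i) % n) = c j) :
    (X ^ n - 1 : E[X]) ∣ (∑ i ∈ Finset.range n, C (v i) * X ^ i) * gPoly q n α -
      ∑ j ∈ Finset.range n, C (c j) * X ^ j := by
  rw [← Ideal.Quotient.eq_zero_iff_dvd, map_sub, sub_eq_zero, map_mul]
  set π := Ideal.Quotient.mk (Ideal.span {(X ^ n - 1 : E[X])})
  have hy : π X ^ n = 1 := by
    rw [← sub_eq_zero, ← map_pow, ← map_one π, ← map_sub, Ideal.Quotient.eq_zero_iff_dvd]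
  have := cyclic_mul_eq hy (fun i => π (C (v i))) (fun k => π (C (α ^ q ^ k)))
    (fun j => π (C (c j))) fun j hj => by
      rw [← h j hj]
      simp only [map_sum, map_mul]
  simpa only [gPoly, map_sum, map_mul, map_pow] using this

theorem isKNormal_of_bezout {q n : ℕ} {α : E} {f h : E[X]} (hn : n ≠ 0)
    (hfh : f * h = X ^ n - 1) (hh : X ^ n - 1 ∣ h * gPoly q n α)
    (hf : ∃ v, X ^ n - 1 ∣ v * gPoly q n α - f) : IsKNormal q n f.natDegree α := by
  classical
  obtain ⟨v, hv⟩ := hf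
  have hX : (X ^ n - 1 : E[X]) ≠ 0 := X_pow_sub_C_ne_zero (Nat.pos_of_ne_zero hn) 1
  have hh0 : h ≠ 0 := by
    rintro rfl
    exact hX (by rw [← hfh, mul_zero])
  have hfg : f ∣ gPoly q n α := by
    rw [← hfh, mul_comm f] at hh
    exact (mul_dvd_mul_iff_left hh0).1 hh
  unfold IsKNormal
  refine natDegree_eq_of_degree_eq (degree_eq_degree_of_associated
    (associated_of_dvd_dvd ?_ ?_))
  · have h1 := @EuclideanDomain.gcd_dvd_left _ _ (Classical.decEq _) (X ^ n - 1) (gPoly q n α)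
    have h2 := @EuclideanDomain.gcd_dvd_right _ _ (Classical.decEq _) (X ^ n - 1) (gPoly q n α)
    exact (dvd_sub_right (h2.mul_left v)).1 (h1.trans hv)
  · exact @EuclideanDomain.dvd_gcd _ _ (Classical.decEq _) _ _ _ (hfh ▸ dvd_mul_right f h) hfg

end CyclicProducts

section Certificates

/-- Data for exhibiting a primitive `2`-normal element of `F_{q^n}` as a root of the polynomial
`x ^ d - T(x)` over `F_p`. Elements of `F_p[x]` are encoded by evaluating at `p` the lift with
coefficients in `[0, p)`. -/
structure NormalCert where
  /-- The characteristic. -/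
  p : ℕ
  /-- The degree of the extension over the prime field. -/
  d : ℕ
  /-- The size of the base field. -/
  q : ℕ
  /-- The degree of the extension over the base field. -/
  n : ℕ
  /-- The code of `T`. -/
  tail : ℕ
  /-- The degree of `T`. -/
  tailDegree : ℕ
  /-- A number of substitutions of `T` for `x ^ d` that reduces products of reduced polynomials. -/
  passes : ℕ
  /-- The constant and linear coefficients of the gcd. -/
  f : ℕ × ℕ
  /-- The coefficients of the cofactor of the gcd in `X ^ n - 1`. -/
  h : List ℕ
  /-- The codes of the conjugates of the root. -/
  conj : List ℕ
  /-- The codes of the coefficients of a Bezout multiplier. -/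
  v : List ℕ
  /-- The primes `r` dividing `p ^ d - 1`, with codes of the inverses of
  `x ^ ((p ^ d - 1) / r) - 1`. -/
  primes : List (ℕ × ℕ)

/-- Evaluates `m` before passing it to `k`, which keeps kernel computations small. -/
def forceNat {α : Type*} (m : ℕ) (k : ℕ → α) : α :=
  match m with
  | 0 => k 0
  | m + 1 => k (m + 1)

theorem forceNat_eq {α : Type*} (m : ℕ) (k : ℕ → α) : forceNat m k = k m := by
  cases m <;> rfl

/-- Evaluates the list `l.map g` before passing it to `k`. -/
def forceMap {α : Type*} (g : ℕ → ℕ) : List ℕ → (List ℕ → α) → α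
  | [], k => k []
  | m :: l, k => forceNat (g m) fun a => forceMap g l fun l => k (a :: l)

theorem forceMap_eq {α : Type*} (g : ℕ → ℕ) (l : List ℕ) (k : List ℕ → α) :
    forceMap g l k = k (l.map g) := by
  induction l generalizing k with
  | nil => rfl
  | cons m l ih => rw [forceMap, forceNat_eq, ih, List.map_cons]

/-- Trial division. -/
def trialDivision (r : ℕ) : Bool := 2 ≤ r && (List.range r).all fun m => m < 2 || r % m != 0

theorem prime_of_trialDivision {r : ℕ} (h : trialDivision r = true) : r.Prime := by
  simp only [trialDivision, Bool.and_eq_true, decide_eq_true_eq, List.all_eq_true, List.mem_range,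
    Bool.or_eq_true, bne_iff_ne] at h
  refine Nat.prime_def_lt'.2 ⟨h.1, fun m hm hmr hd => ?_⟩
  rcases h.2 m hmr with h | h
  · omega
  · exact h (Nat.mod_eq_zero_of_dvd hd)

namespace NormalCert

/-- The base used for packing coefficients; the kernel hashes numerals by their residue modulo a
power of two, so that a power of two would be slow. -/
def base : ℕ := 3 ^ 41

variable (c : NormalCert)

/-- The packed form of `T`. -/
def packedTail : ℕ := rebase base c.p c.p (c.tailDegree + 1) c.tail

/-- The packed form of the polynomial with a given code. -/
def pack (m : ℕ) : ℕ := rebase base c.p c.p c.d m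

/-- Reduction of a packed polynomial. -/
def norm (m : ℕ) : ℕ :=
  forceNat m fun m =>
    forceNat (reducePacked base c.d c.packedTail c.passes m) (rebase base base c.p c.d)

/-- Binary powering of packed polynomials, for exponents below `2 ^ s`. -/
def pow (a : ℕ) : ℕ → ℕ → ℕ
  | 0, _ => 1
  | s + 1, e =>
    if e = 0 then 1 else
      forceNat (pow a s (e / 2)) fun b =>
        forceNat (c.norm (b * b)) fun b => if e % 2 = 0 then b else c.norm (b * a)

/-- A bound on the coefficients before reduction. -/
def bound : ℕ := c.n * (c.d * ((c.p - 1) * (c.p - 1)))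

/-- The check that the parameters are sensible. -/
def paramsCheck : Bool :=
  2 ≤ c.p && 3 ≤ c.n && c.tailDegree < c.d && c.d - 1 ≤ c.passes * (c.d - c.tailDegree) &&
    c.bound * (1 + (c.tailDegree + 1) * (c.p - 1)) ^ c.passes < base && c.p < base &&
    c.p ^ c.d = c.q ^ c.n

/-- The check that the root is primitive. -/
def primitiveCheck : Bool :=
  2 ≤ c.d && c.p ^ c.d - 1 < 2 ^ 64 && c.pow base 64 (c.p ^ c.d - 1) = 1 &&
    (c.primes.map Prod.fst).prod ^ 64 % (c.p ^ c.d - 1) = 0 &&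
    c.primes.all fun r => trialDivision r.1 &&
      c.norm (c.pack r.2 * c.pow base 64 ((c.p ^ c.d - 1) / r.1)) =
        rebase base base c.p c.d (c.pack r.2 + 1)

/-- The coefficients of the gcd. -/
def gcdCoeff : List ℕ := [c.f.1, c.f.2, 1]

/-- The coefficient of index `j` in the product, modulo `X ^ n - 1`, of the polynomial with
packed coefficients `v` and of `g_α`, given the packed conjugates `A` of `α`. -/
def cyclicCoeff (v A : List ℕ) (j : ℕ) : ℕ :=
  c.norm ((List.range c.n).map fun i => v.getD i 0 * A.getD ((c.n - 1 - j + i) % c.n) 0).sum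

/-- The check that the root is `2`-normal. -/
def normalCheck : Bool :=
  c.q < 2 ^ 64 && c.h.length ≤ c.n && c.h.all (· < c.p) && c.gcdCoeff.all (· < c.p) &&
    (mulDigits c.gcdCoeff c.h).map (· % c.p) =
      (c.p - 1) :: (List.replicate (c.n - 1) 0 ++ [1]) &&
    forceMap c.pack c.conj fun A => forceMap c.pack c.v fun v =>
      A.getD 0 0 = base &&
      ((List.range (c.n - 1)).all fun i => c.pow (A.getD i 0) 64 c.q = A.getD (i + 1) 0) &&
      (List.range c.n).all fun j =>
        c.cyclicCoeff c.h A j = 0 && c.cyclicCoeff v A j = c.gcdCoeff.getD j 0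

/-- The full check. -/
def check : Bool := c.paramsCheck && c.primitiveCheck && c.normalCheck

end NormalCert

theorem ofDigits_eq_sum_getD {R : Type*} [CommSemiring R] (a : R) {l : List ℕ} {n : ℕ}
    (h : l.length ≤ n) : Nat.ofDigits a l = ∑ i ∈ Finset.range n, (l.getD i 0 : R) * a ^ i := by
  induction l generalizing n with
  | nil => simp [Nat.ofDigits]
  | cons x l ih =>
    obtain ⟨n, rfl⟩ : ∃ m, n = m + 1 := ⟨n - 1, by rw [List.length_cons] at h; omega⟩
    rw [ofDigits_cons_eq, ih (by simpa using h), Finset.sum_range_succ', Finset.mul_sum, add_comm]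
    simp only [List.getD_cons_succ, List.getD_cons_zero, pow_zero, mul_one, pow_succ]
    congr 1
    exact Finset.sum_congr rfl fun i _ => by ring

theorem degree_ofDigits_X_lt {E : Type*} [Field E] {l : List ℕ} {n : ℕ} (h : l.length ≤ n) :
    (Nat.ofDigits (X : E[X]) l).degree < n := by
  rw [ofDigits_eq_sum_getD _ h, ← mem_degreeLT]
  refine Submodule.sum_mem _ fun i hi => mem_degreeLT.2 ?_
  rw [← map_natCast C]
  exact (degree_C_mul_X_pow_le _ _).trans_lt (by exact_mod_cast Finset.mem_range.1 hi)

theorem map_ofDigits {R S : Type*} [CommSemiring R] [CommSemiring S] (φ : R →+* S) (a : R)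
    (l : List ℕ) : φ (Nat.ofDigits a l) = Nat.ofDigits (φ a) l := by
  rw [ofDigits_eq_sum_getD _ le_rfl, ofDigits_eq_sum_getD _ le_rfl]
  simp

theorem ofDigits_map_mod {R : Type*} [CommSemiring R] {a : R} {p : ℕ} (hp : (p : R) = 0)
    (l : List ℕ) : Nat.ofDigits a (l.map (· % p)) = Nat.ofDigits a l := by
  induction l with
  | nil => rfl
  | cons x l ih =>
    rw [List.map_cons, ofDigits_cons_eq, ofDigits_cons_eq, ih]
    congr 1
    conv_rhs => rw [← Nat.mod_add_div x p, Nat.cast_add, Nat.cast_mul, hp, zero_mul, add_zero]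

theorem ofDigits_replicate_append {R : Type*} [CommSemiring R] (a : R) (m : ℕ) :
    Nat.ofDigits a (List.replicate m 0 ++ [1]) = a ^ m := by
  induction m with
  | zero => simp [Nat.ofDigits]
  | succ m ih =>
    rw [List.replicate_succ, List.cons_append, ofDigits_cons_eq, ih, Nat.cast_zero, zero_add,
      pow_succ']

namespace NormalCert

variable (c : NormalCert)

theorem one_lt_base : 1 < base := by norm_num [base]

section ring

variable {R : Type*} [CommRing R]

/-- `a` is a root of `x ^ d - T(x)` in a ring of characteristic `p`. -/
structure IsRoot (a : R) : Prop where
  cast_eq_zero : (c.p : R) = 0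
  pow_eq : a ^ c.d = Nat.ofDigits a (Nat.digits base c.packedTail)

/-- The number `m` packs the coefficients of a reduced polynomial whose value at `a` is `e`. -/
def Rep (a : R) (m : ℕ) (e : R) : Prop := Packs base a (c.p - 1) c.d m e

variable {c} {a e e' : R} {m m' : ℕ} (hc : c.paramsCheck = true)

theorem paramsCheck_iff : c.paramsCheck = true ↔ 2 ≤ c.p ∧ 3 ≤ c.n ∧ c.tailDegree < c.d ∧
    c.d - 1 ≤ c.passes * (c.d - c.tailDegree) ∧
    c.bound * (1 + (c.tailDegree + 1) * (c.p - 1)) ^ c.passes < base ∧ c.p < base ∧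
    c.p ^ c.d = c.q ^ c.n := by
  simp only [paramsCheck, Bool.and_eq_true, decide_eq_true_eq, and_assoc]

theorem rep_zero : c.Rep a 0 0 := Packs.zero

include hc

theorem Rep.unique (h : c.Rep a m e) (h' : c.Rep a m e') : e = e' := by
  have := (paramsCheck_iff.1 hc).2.2.2.2.2.1
  exact Packs.unique h h' one_lt_base (by omega) (by omega)

theorem rep_natCast (h : m < c.p) : c.Rep a m m := by
  obtain ⟨d, hd⟩ : ∃ d, c.d = d + 1 :=
    ⟨c.d - 1, by have := (paramsCheck_iff.1 hc).2.2.1; omega⟩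
  rw [Rep, hd]
  exact Packs.natCast (by omega)

theorem rep_one : c.Rep a 1 1 := by
  have := rep_natCast (a := a) hc (m := 1) (by have := (paramsCheck_iff.1 hc).1; omega)
  rwa [Nat.cast_one] at this

theorem rep_base (hd : 2 ≤ c.d) : c.Rep a base a := by
  have := (paramsCheck_iff.1 hc).1
  exact (Packs.self (L := 0)).mono (by omega) hd

theorem exists_rep_pack (m : ℕ) : ∃ e, c.Rep a (c.pack m) e :=
  Packs.exists_rebase (by have := (paramsCheck_iff.1 hc).1; omega) _ _

theorem rep_norm {K : ℕ} (ha : c.IsRoot a) (h : Packs base a K (c.d + (c.d - 1)) m e)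
    (hK : K ≤ c.bound) : c.Rep a (c.norm m) e := by
  obtain ⟨h1, h2, h3, h4, h5, h6, h7⟩ := paramsCheck_iff.1 hc
  rw [norm, forceNat_eq, forceNat_eq]
  obtain ⟨t, ht⟩ : ∃ t, Packs base a (c.p - 1) (c.tailDegree + 1) c.packedTail t :=
    Packs.exists_rebase (by omega) _ _
  obtain rfl : t = a ^ c.d := by rw [ha.pow_eq, ht.eq_ofDigits one_lt_base (by omega)]
  have := Packs.reduce ht h3 (by omega) c.passes (h.mono hK le_rfl) h5
  exact this.normalize (by omega) ha.cast_eq_zero h5 (by omega)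

theorem packs_mul (h : c.Rep a m e) (h' : c.Rep a m' e') :
    Packs base a (c.d * ((c.p - 1) * (c.p - 1))) (c.d + (c.d - 1)) (m * m') (e * e') := by
  obtain ⟨d, hd⟩ : ∃ d, c.d = d + 1 :=
    ⟨c.d - 1, by have := (paramsCheck_iff.1 hc).2.2.1; omega⟩
  rw [Rep, hd] at h h'
  rw [hd]
  exact (h.mul h').mono le_rfl (by omega)

theorem rep_norm_mul (ha : c.IsRoot a) (h : c.Rep a m e) (h' : c.Rep a m' e') :
    c.Rep a (c.norm (m * m')) (e * e') :=
  rep_norm hc ha (packs_mul hc h h')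
    (Nat.le_mul_of_pos_left _ (by have := (paramsCheck_iff.1 hc).2.1; omega))

theorem rep_pow (ha : c.IsRoot a) (h : c.Rep a m e) (s : ℕ) {k : ℕ} (hk : k < 2 ^ s) :
    c.Rep a (c.pow m s k) (e ^ k) := by
  induction s generalizing k with
  | zero =>
    obtain rfl : k = 0 := by omega
    rw [pow_zero]
    exact rep_one hc
  | succ s ih =>
    rw [pow]
    split_ifs with hk0 h2
    · rw [hk0, pow_zero]
      exact rep_one hc
    all_goals
      have hb := ih (k := k / 2) (by omega)
      have hb2 := rep_norm_mul hc ha hb hb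
      rw [← pow_add] at hb2
      rw [forceNat_eq, forceNat_eq]
    · convert hb2 using 2
      omega
    · have := rep_norm_mul hc ha hb2 h
      rw [← pow_succ] at this
      convert this using 2
      omega

theorem rep_cyclicCoeff (ha : c.IsRoot a) {v A : List ℕ} {w b : ℕ → R}
    (hv : ∀ i < c.n, c.Rep a (v.getD i 0) (w i)) (hA : ∀ i < c.n, c.Rep a (A.getD i 0) (b i))
    (j : ℕ) : c.Rep a (c.cyclicCoeff v A j)
      (∑ i ∈ Finset.range c.n, w i * b ((c.n - 1 - j + i) % c.n)) := by
  have hsum := Packs.sum (s := Finset.range c.n) fun i hi =>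
    packs_mul hc (hv i (Finset.mem_range.1 hi))
      (hA _ (Nat.mod_lt (c.n - 1 - j + i) (by have := Finset.mem_range.1 hi; omega)))
  rw [Finset.card_range] at hsum
  exact rep_norm hc ha hsum le_rfl

end ring

section field

variable {c} {E : Type*} [Field E] [Fintype E] (hc : c.paramsCheck = true)
  (hE : Fintype.card E = c.q ^ c.n)
include hc hE

omit [Field E] in
theorem card_eq : Fintype.card E = c.p ^ c.d := by rw [hE, (paramsCheck_iff.1 hc).2.2.2.2.2.2]

theorem cast_eq_zero : (c.p : E) = 0 := by
  have h := FiniteField.cast_card_eq_zero E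
  rw [card_eq hc hE, Nat.cast_pow] at h
  exact eq_zero_of_pow_eq_zero h

theorem exists_isRoot (hd : 2 ≤ c.d) (hN : c.p ^ c.d - 1 < 2 ^ 64)
    (hpow : c.pow base 64 (c.p ^ c.d - 1) = 1) : ∃ α : E, c.IsRoot α := by
  obtain ⟨h1, h2, h3, h4, h5, h6, h7⟩ := paramsCheck_iff.1 hc
  have hp0 := cast_eq_zero hc hE
  set T : E[X] := Nat.ofDigits X (Nat.digits base c.packedTail) with hT
  have hdeg : T.degree < c.d := by
    obtain ⟨t, l, hl, hlp, hle, hlX⟩ : ∃ t : E[X],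
        Packs base X (c.p - 1) (c.tailDegree + 1) c.packedTail t :=
      Packs.exists_rebase (by omega) _ _
    rw [hT, ← hle, ofDigits_digits_ofDigits _ one_lt_base fun x hx => by have := hlp x hx; omega]
    exact degree_ofDigits_X_lt (by omega)
  set F : E[X] := X ^ c.d - T with hF
  have hFd : F.degree = c.d := by
    rw [hF, degree_sub_eq_left_of_degree_lt] <;> simp [hdeg]
  have hroot : c.IsRoot (AdjoinRoot.root F) := by
    constructor
    · rw [← map_natCast (AdjoinRoot.of F), hp0, map_zero]
    · have := AdjoinRoot.mk_self (f := F)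
      rw [hF, map_sub, sub_eq_zero, ← hF, map_pow, AdjoinRoot.mk_X] at this
      rw [this, hT, ← AdjoinRoot.mk_X]
      exact (map_ofDigits _ _ _)
  have hone : AdjoinRoot.root F ^ (c.p ^ c.d - 1) = 1 := by
    have := rep_pow hc hroot (rep_base hc hd) 64 hN
    rw [hpow] at this
    exact Rep.unique hc this (rep_one hc)
  have hdvd : F ∣ X ^ Fintype.card E - X := by
    rw [← AdjoinRoot.mk_eq_zero, map_sub, map_pow, AdjoinRoot.mk_X, card_eq hc hE,
      ← Nat.sub_add_cancel (Nat.one_le_pow c.d c.p (by omega)), pow_succ, hone, one_mul, sub_self]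
  have hsplit : (X ^ Fintype.card E - X : E[X]).Splits := by
    rw [splits_iff_card_roots, FiniteField.roots_X_pow_card_sub_X,
      FiniteField.X_pow_card_sub_X_natDegree_eq _ Fintype.one_lt_card]
    rfl
  obtain ⟨α, hα⟩ := (hsplit.of_dvd
    (FiniteField.X_pow_card_sub_X_ne_zero _ Fintype.one_lt_card) hdvd).exists_eval_eq_zero
      (by rw [hFd]; exact_mod_cast (by omega : c.d ≠ 0))
  refine ⟨α, hp0, ?_⟩
  rw [hF, eval_sub, sub_eq_zero, eval_pow, eval_X] at hα
  rw [hα, hT, ← coe_evalRingHom, map_ofDigits, coe_evalRingHom, eval_X]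

theorem isPrimitiveElem_of_check {α : E} (hα : c.IsRoot α) (h : c.primitiveCheck = true) :
    IsPrimitiveElem α := by
  simp only [primitiveCheck, Bool.and_eq_true, decide_eq_true_eq, List.all_eq_true] at h
  obtain ⟨⟨⟨⟨hd, hN⟩, hpow⟩, hprod⟩, hprimes⟩ := h
  obtain ⟨h1, h2, h3, h4, h5, h6, h7⟩ := paramsCheck_iff.1 hc
  have hrep := fun k hk => rep_pow hc hα (rep_base hc hd) 64 (k := k) hk
  have hN0 : 0 < c.p ^ c.d - 1 := Nat.sub_pos_of_lt (Nat.one_lt_pow (by omega) (by omega))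
  rw [IsPrimitiveElem, card_eq hc hE]
  refine orderOf_eq_of_pow_and_pow_div_prime hN0 ?_ fun r hr hrN => ?_
  · have := hrep _ hN
    rw [hpow] at this
    exact Rep.unique hc this (rep_one hc)
  · have hmem : r ∈ c.primes.map Prod.fst := by
      have h := hr.dvd_of_dvd_pow (hrN.trans (Nat.dvd_of_mod_eq_zero hprod))
      obtain ⟨s, hs, hrs⟩ := (Prime.dvd_prod_iff hr.prime).1 h
      obtain ⟨x, hx, rfl⟩ := List.mem_map.1 hs
      rwa [(Nat.prime_dvd_prime_iff_eq hr (prime_of_trialDivision (hprimes x hx).1)).1 hrs]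
    obtain ⟨x, hx, rfl⟩ := List.mem_map.1 hmem
    obtain ⟨e, he⟩ := exists_rep_pack (a := α) hc x.2
    have hl := rep_norm_mul hc hα he (hrep _ ((Nat.div_le_self _ x.1).trans_lt hN))
    rw [(hprimes x hx).2] at hl
    have h1' : Packs base α 1 c.d 1 1 := by
      have := Packs.natCast (B := base) (a := α) (K := 1) (L := c.d - 1) le_rfl
      rwa [Nat.cast_one, Nat.sub_add_cancel (by omega)] at this
    have hsucc : c.Rep α (rebase base base c.p c.d (c.pack x.2 + 1)) (e + 1) :=
      (he.add h1').normalize (by omega) hα.cast_eq_zero (by omega) le_rfl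
    intro hone
    have := Rep.unique hc hl hsucc
    rw [hone, mul_one] at this
    exact one_ne_zero (left_eq_add.1 this)

theorem isKNormal_of_check {α : E} (hα : c.IsRoot α) (hd : 2 ≤ c.d) (h : c.normalCheck = true) :
    IsKNormal c.q c.n 2 α := by
  simp only [normalCheck, forceMap_eq, Bool.and_eq_true, decide_eq_true_eq, List.all_eq_true,
    List.mem_range, and_assoc] at h
  obtain ⟨hq, hlen, hhp, hfp, hfh, hA0, hA, hcoeff⟩ := h
  obtain ⟨h1, h2, h3, h4, h5, h6, h7⟩ := paramsCheck_iff.1 hc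
  have hp0 := cast_eq_zero hc hE
  set A := c.conj.map c.pack
  set v := c.v.map c.pack
  have hrepA : ∀ i < c.n, c.Rep α (A.getD i 0) (α ^ c.q ^ i) := by
    intro i hi
    induction i with
    | zero =>
      rw [hA0, pow_zero, pow_one]
      exact rep_base hc hd
    | succ i ih =>
      rw [← hA i (by omega), pow_succ, pow_mul]
      exact rep_pow hc hα (ih (by omega)) 64 hq
  have hrepv : ∀ i, ∃ w, c.Rep α (v.getD i 0) w := fun i => by
    rcases lt_or_ge i v.length with hi | hi
    · rw [List.getD_eq_getElem _ _ hi, List.getElem_map]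
      exact exists_rep_pack hc _
    · rw [List.getD_eq_default _ _ hi]
      exact ⟨0, rep_zero⟩
  choose w hw using hrepv
  have hrepC : ∀ l : List ℕ, (∀ x ∈ l, x < c.p) → ∀ i, c.Rep α (l.getD i 0) (l.getD i 0) :=
    fun l hl i => by
      refine rep_natCast hc ?_
      rcases lt_or_ge i l.length with hi | hi
      · rw [List.getD_eq_getElem _ _ hi]
        exact hl _ (List.getElem_mem hi)
      · rw [List.getD_eq_default _ _ hi]
        omega
  have hX := fun (l : List ℕ) (hl : l.length ≤ c.n) => ofDigits_eq_sum_getD (X : E[X]) hl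
  simp only [← map_natCast (C : E →+* E[X])] at hX
  have hdeg : (Nat.ofDigits (X : E[X]) c.gcdCoeff).natDegree = 2 := by
    simp only [gcdCoeff, Nat.ofDigits]
    simp only [← map_natCast (C : E →+* E[X]), Nat.cast_one, mul_zero, add_zero, map_one]
    compute_degree!
  rw [← hdeg]
  refine isKNormal_of_bezout (h := Nat.ofDigits X c.h) (by omega) ?_ ?_
    ⟨∑ i ∈ Finset.range c.n, C (w i) * X ^ i, ?_⟩
  · have hpX : (c.p : E[X]) = 0 := by rw [← map_natCast C, hp0, map_zero]
    rw [← ofDigits_mulDigits, ← ofDigits_map_mod hpX, hfh, ofDigits_cons_eq,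
      ofDigits_replicate_append, Nat.cast_sub (by omega), hpX, Nat.cast_one, ← pow_succ',
      Nat.sub_add_cancel (by omega)]
    ring
  · have := X_pow_sub_one_dvd_mul_gPoly_sub (q := c.q) (α := α)
      (fun i => ((c.h.getD i 0 : ℕ) : E)) 0 fun j hj => by
        have := rep_cyclicCoeff hc hα (fun i _ => hrepC c.h hhp i) hrepA j
        rw [(hcoeff j hj).1] at this
        exact Rep.unique hc this rep_zero
    rw [hX _ hlen]
    simpa using this
  · have := X_pow_sub_one_dvd_mul_gPoly_sub (q := c.q) (α := α) w
      (fun j => ((c.gcdCoeff.getD j 0 : ℕ) : E)) fun j hj => by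
        have := rep_cyclicCoeff hc hα (fun i _ => hw i) hrepA j
        rw [(hcoeff j hj).2] at this
        exact Rep.unique hc this (hrepC _ hfp j)
    rwa [hX c.gcdCoeff (by simpa [gcdCoeff] using h2)]

omit hc in
theorem exists_of_check (h : c.check = true) :
    ∃ α : E, IsPrimitiveElem α ∧ IsKNormal c.q c.n 2 α := by
  simp only [check, Bool.and_eq_true] at h
  obtain ⟨⟨hc, hp⟩, hn⟩ := h
  have hp' := hp
  simp only [primitiveCheck, Bool.and_eq_true, decide_eq_true_eq] at hp'
  obtain ⟨⟨⟨⟨hd, hN⟩, hpow⟩, -⟩, -⟩ := hp'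
  obtain ⟨α, hα⟩ := exists_isRoot hc hE hd hN hpow
  exact ⟨α, isPrimitiveElem_of_check hc hE hα hp, isKNormal_of_check hc hE hα hd hn⟩

end field

end NormalCert

/-- Certificates for the pairs in `smallPairs`. -/
def normalCerts : List NormalCert :=
  [{ p := 2, d := 8, q := 2, n := 8, tail := 43, tailDegree := 5, passes := 3, f := (1, 0), h
      := [1, 0, 1, 0, 1, 0, 1], conj := [2, 4, 16, 43, 233, 238, 251, 193], v := [252, 212, 196,
      19, 210, 44, 0, 0], primes := [(3, 235), (5, 215), (17, 255)] },
    { p := 3, d := 8, q := 3, n := 8, tail := 103, tailDegree := 4, passes := 2, f := (2, 0), h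
      := [1, 0, 1, 0, 1, 0, 1], conj := [3, 27, 309, 5299, 555, 3284, 69, 1239], v := [3053, 3737,
      4247, 2783, 3767, 792, 0, 0], primes := [(2, 1), (5, 3309), (41, 5789)] },
    { p := 2, d := 16, q := 4, n := 8, tail := 407, tailDegree := 8, passes := 2, f := (1, 0), h
      := [1, 0, 1, 0, 1, 0, 1], conj := [2, 16, 407, 9307, 58186, 11475, 58079, 2200], v
      := [15381, 18754, 43730, 22875, 58113, 43605, 0, 0], primes := [(3, 53131), (5, 22788), (17,
      64148), (257, 22918)] },
    { p := 5, d := 8, q := 5, n := 8, tail := 137, tailDegree := 3, passes := 2, f := (4, 0), h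
      := [1, 0, 1, 0, 1, 0, 1], conj := [5, 3125, 109652, 10025, 159319, 296256, 204309, 193874],
      v := [3125, 109652, 13150, 268341, 290656, 20, 0, 0], primes := [(2, 2), (3, 108079), (13,
      95639), (313, 159311)] },
    { p := 3, d := 16, q := 9, n := 8, tail := 376, tailDegree := 5, passes := 2, f := (2, 1), h
      := [1, 1, 2, 0, 2, 2, 1], conj := [3, 19683, 19437360, 19080414, 11993746, 13671070,
      25215422, 17252112], v := [41730033, 37048556, 10436822, 27968580, 39579749, 24173504, 0,
      0], primes := [(2, 1), (5, 4840602), (17, 29430404), (41, 3876155), (193, 34134453)] },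
    { p := 2, d := 9, q := 2, n := 9, tail := 291, tailDegree := 8, passes := 8, f := (1, 1), h
      := [1, 1, 0, 1, 1, 0, 1, 1], conj := [2, 4, 16, 256, 191, 215, 259, 186, 198], v := [279,
      189, 211, 4, 263, 170, 209, 0, 0], primes := [(7, 154), (73, 328)] },
    { p := 3, d := 9, q := 3, n := 9, tail := 83, tailDegree := 4, passes := 2, f := (1, 1), h
      := [2, 1, 0, 2, 1, 0, 2, 1], conj := [3, 27, 83, 2243, 3123, 6795, 4407, 5951, 13158], v
      := [8076, 8240, 18448, 15514, 14653, 13856, 13858, 0, 0], primes := [(2, 1), (13, 1608),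
      (757, 14327)] },
    { p := 2, d := 18, q := 4, n := 9, tail := 483, tailDegree := 8, passes := 2, f := (1, 1), h
      := [1, 1, 0, 1, 1, 0, 1, 1], conj := [2, 16, 65536, 54018, 44059, 143871, 54017, 44042,
      209406], v := [256, 54370, 5135, 200253, 33071, 216698, 4, 0, 0], primes := [(3, 133090),
      (7, 182658), (19, 127295), (73, 129511)] },
    { p := 2, d := 10, q := 2, n := 10, tail := 39, tailDegree := 5, passes := 2, f := (1, 0), h
      := [1, 0, 1, 0, 1, 0, 1, 0, 1], conj := [2, 4, 16, 256, 398, 938, 386, 1018, 30, 340], v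
      := [630, 944, 688, 328, 804, 934, 932, 470, 0, 0], primes := [(3, 34), (11, 787), (31, 66)]
      },
    { p := 3, d := 10, q := 3, n := 10, tail := 103, tailDegree := 4, passes := 2, f := (2, 0), h
      := [1, 0, 1, 0, 1, 0, 1, 0, 1], conj := [3, 27, 19683, 15322, 39681, 9017, 23568, 51896,
      45108, 38557], v := [32450, 46754, 25686, 26483, 41625, 7436, 14791, 37612, 0, 0], primes
      := [(2, 1), (11, 38157), (61, 23965)] },
    { p := 2, d := 12, q := 2, n := 12, tail := 83, tailDegree := 6, passes := 2, f := (1, 0), h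
      := [1, 0, 1, 0, 1, 0, 1, 0, 1, 0, 1], conj := [2, 4, 16, 256, 1328, 559, 198, 267, 1397,
      621, 145, 77], v := [256, 1328, 815, 1526, 548, 131, 73, 18, 4, 16, 0, 0], primes := [(3,
      70), (5, 1971), (7, 1799), (13, 1177)] },
    { p := 3, d := 12, q := 3, n := 12, tail := 247, tailDegree := 5, passes := 2, f := (1, 1), h
      := [2, 1, 0, 2, 1, 0, 2, 1, 0, 2, 1], conj := [3, 27, 19683, 53661, 352069, 312160, 310656,
      511133, 524801, 452522, 132950, 119852], v := [26831, 80681, 193627, 509666, 139329, 26849,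
      92757, 172756, 172728, 159193, 0, 0], primes := [(2, 1), (5, 291039), (7, 200508), (13,
      396981), (73, 337674)] },
    { p := 2, d := 24, q := 4, n := 12, tail := 1725, tailDegree := 10, passes := 2, f := (1, 0),
      h := [1, 0, 1, 0, 1, 0, 1, 0, 1, 0, 1], conj := [2, 16, 65536, 2201353, 270322, 9686128,
      3523803, 7707524, 2036259, 6696024, 3131656, 10611893], v := [13234690, 16213240, 2416748,
      6757132, 4638668, 7494843, 11502032, 8949508, 5971269, 14354582, 0, 0], primes := [(3,
      15658474), (5, 11184398), (7, 6996173), (13, 1706379), (17, 13809631), (241, 4842130)] },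
    { p := 2, d := 14, q := 2, n := 14, tail := 83, tailDegree := 6, passes := 2, f := (1, 0), h
      := [1, 0, 1, 0, 1, 0, 1, 0, 1, 0, 1, 0, 1], conj := [2, 4, 16, 256, 332, 4380, 3331, 1754,
      231, 5190, 2507, 521, 1393, 141], v := [332, 4380, 3151, 6086, 3240, 896, 1379, 393, 18,
      260, 16, 256, 0, 0], primes := [(3, 9386), (43, 14390), (127, 1349)] },
    { p := 2, d := 15, q := 2, n := 15, tail := 19517, tailDegree := 14, passes := 14, f := (1,
      1), h := [1, 1, 0, 1, 1, 0, 1, 1, 0, 1, 1, 0, 1, 1], conj := [2, 4, 16, 256, 21575, 12174,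
      23432, 28187, 26286, 30223, 12425, 18650, 11396, 2768, 491], v := [30220, 18048, 30791,
      4930, 13715, 2229, 26285, 6, 20, 30492, 5063, 910, 26436, 0, 0], primes := [(7, 6039), (31,
      20952), (151, 1316)] },
    { p := 3, d := 15, q := 3, n := 15, tail := 11, tailDegree := 2, passes := 2, f := (1, 1), h
      := [2, 1, 0, 2, 1, 0, 2, 1, 0, 2, 1, 0, 2, 1], conj := [3, 27, 19683, 5845851, 5447121,
      5775110, 778687, 771617, 606683, 959751, 957519, 812448, 10691370, 9684392, 9585786], v
      := [9777112, 5501815, 5567434, 620283, 9625558, 9566022, 4994137, 187399, 186679, 9962036,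
      9977838, 5175957, 4815103, 0, 0], primes := [(2, 1), (11, 10655035), (13, 3967850), (4561,
      1885447)] },
    { p := 2, d := 16, q := 2, n := 16, tail := 303, tailDegree := 8, passes := 2, f := (1, 0), h
      := [1, 0, 1, 0, 1, 0, 1, 0, 1, 0, 1, 0, 1, 0, 1], conj := [2, 4, 16, 256, 303, 1402, 1691,
      22281, 55715, 16802, 42373, 27323, 21035, 52856, 10667, 46614], v := [15862, 39832, 40195,
      63484, 34865, 53000, 114, 5380, 22, 276, 15817, 40653, 40909, 41748, 0, 0], primes := [(3,
      35492), (5, 56461), (17, 28311), (257, 55518)] },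
    { p := 2, d := 18, q := 2, n := 18, tail := 39, tailDegree := 5, passes := 2, f := (1, 0), h
      := [1, 0, 1, 0, 1, 0, 1, 0, 1, 0, 1, 0, 1, 0, 1, 0, 1], conj := [2, 4, 16, 256, 65536,
      114766, 211994, 191545, 118194, 158630, 195676, 118883, 209291, 241620, 116106, 158870,
      260583, 87540], v := [92, 4432, 71836, 101038, 259601, 555, 1086, 1480, 86144, 71054, 35098,
      226100, 227066, 140910, 209580, 175078, 0, 0], primes := [(3, 95781), (7, 2978), (19,
      247120), (73, 226777)] },
    { p := 3, d := 18, q := 3, n := 18, tail := 1048, tailDegree := 6, passes := 2, f := (1, 1), h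
      := [2, 1, 0, 2, 1, 0, 2, 1, 0, 2, 1, 0, 2, 1, 0, 2, 1], conj := [3, 27, 19683, 20627784,
      28767006, 296447896, 68608191, 215218042, 347053960, 123143163, 50400109, 375128617,
      46096637, 339809489, 33762490, 128747631, 5110135, 95361877], v := [330056764, 254899452,
      151309633, 15882188, 311475609, 113306455, 326638744, 244488542, 296393845, 216479220,
      135864157, 307096185, 339926647, 113485665, 311940736, 347476577, 0, 0], primes := [(2, 1),
      (7, 78835311), (13, 240287848), (19, 83253189), (37, 135587660), (757, 61577418)] },
    { p := 2, d := 36, q := 4, n := 18, tail := 1017, tailDegree := 9, passes := 2, f := (1, 0), h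
      := [1, 0, 1, 0, 1, 0, 1, 0, 1, 0, 1, 0, 1, 0, 1, 0, 1], conj := [2, 16, 65536, 66840429579,
      3727373612, 65036276725, 13448411186, 27105972557, 10082346823, 51924803370, 49219866932,
      66842403916, 42309460219, 22265020063, 49416618766, 27932810979, 36680325274, 29306445241],
      v := [58828580353, 61843593794, 13727066050, 16169524200, 25177561434, 29747174485,
      66422186841, 40462723791, 26670350771, 38040986756, 46105914318, 21217438249, 9136142317,
      4582755512, 59578380865, 5253855157, 0, 0], primes := [(3, 40086078245), (5, 48844654975),
      (7, 17048125357), (13, 8781812347), (19, 735032519), (37, 30980991144), (73, 34686203479),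
      (109, 34734993064)] }]

theorem check_normalCerts : (normalCerts.all fun c => c.check) = true := by
  decide +kernel

theorem smallPairs_eq_map : smallPairs = normalCerts.map fun c => (c.q, c.n) := rfl

theorem exists_primitive_of_mem_smallPairs {q n : ℕ} (h : (q, n) ∈ smallPairs)
    {E : Type*} [Field E] [Fintype E] (hE : Fintype.card E = q ^ n) :
    ∃ α : E, IsPrimitiveElem α ∧ IsKNormal q n 2 α := by
  rw [smallPairs_eq_map, List.mem_map] at h
  obtain ⟨c, hc, heq⟩ := h
  obtain ⟨rfl, rfl⟩ := Prod.mk.inj heq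
  exact NormalCert.exists_of_check hE (List.all_eq_true.1 check_normalCerts c hc)

end Certificates

/-- For a prime power `q` and `8 ≤ n ≤ 18`, there exists a primitive `2`-normal
element in `F_{q^n}` over `F_q` if and only if `gcd(q^3 - q, n) ≠ 1`. -/
theorem primitive_two_normal_mid_n (q n : ℕ) (hq : IsPrimePow q)
    (hn8 : 8 ≤ n) (hn18 : n ≤ 18)
    (E : Type*) [Field E] [Fintype E] (hE : Fintype.card E = q ^ n) :
    (∃ α : E, IsPrimitiveElem α ∧ IsKNormal q n 2 α) ↔ Nat.gcd (q ^ 3 - q) n ≠ 1 := by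
  refine ⟨fun ⟨_, _, hα⟩ => gcd_ne_one_of_isKNormal hq (by omega) hE hα, fun h => ?_⟩
  rcases le_or_gt 1024 q with hge | hlt
  · exact exists_primitive_of_ge hq hn8 hn18 h hge hE
  by_cases hs : (q, n) ∈ smallPairs
  · exact exists_primitive_of_mem_smallPairs hs hE
  · exact exists_primitive_of_lt hq hn8 hn18 h hlt hs hE

end
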